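/- arXiv:2203.13386 — 12 statements merged into one kernel-verified Lean document; each statement's English description precedes it below -/
import Mathlib

section
/- Let f : ℕ × ℕ → ℂ be discrete analytic and symmetric, i.e. f(m,n) = conj(f(n,m)) for all m,n. Then all the finite section matrices F_N = (f(m,n))_{m,n=0}^{N} (for every N ∈ ℕ) are positive semidefinite if and only if there exists a finite positive Borel measure μ on ℝ supported in [0, 2π] such that f(m,n) = ∫ (√2·e^{-it} - i)^m · (√2·e^{it} + i)^n dμ(t) for all m, n ∈ ℕ. -/
open MeasureTheory
open scoped ComplexOrder

open Filter Topology Polynomial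

/-- `∫ (√2 e^{-it} - i)^m (√2 e^{it} + i)^n dμ(t)`. -/
noncomputable def dafMoment (μ : Measure ℝ) (m n : ℕ) : ℂ :=
  ∫ t : ℝ, ((Real.sqrt 2 : ℂ) * Complex.exp (-(t : ℂ) * Complex.I) - Complex.I) ^ m *
      ((Real.sqrt 2 : ℂ) * Complex.exp ((t : ℂ) * Complex.I) + Complex.I) ^ n ∂μ

section Herglotz

lemma intervalIntegral_exp_int_mul_I (k : ℤ) :
    ∫ t in (0 : ℝ)..2 * Real.pi, Complex.exp (k * t * Complex.I) =
      if k = 0 then (2 * Real.pi : ℂ) else 0 := by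
  split_ifs with hk
  · simp [hk]
  · have hc : (k : ℂ) * Complex.I ≠ 0 := by simp [hk]
    have h := integral_exp_mul_complex (a := 0) (b := 2 * Real.pi) hc
    have he : Complex.exp (k * Complex.I * ((2 * Real.pi : ℝ) : ℂ)) = 1 := by
      rw [← Complex.exp_int_mul_two_pi_mul_I k]
      congr 1
      push_cast
      ring
    rw [he] at h
    simp only [Complex.ofReal_zero, mul_zero, Complex.exp_zero, sub_self, zero_div] at h
    rw [← h]
    refine intervalIntegral.integral_congr fun t _ => ?_
    congr 1
    ring

/-- The Fejér sum of a kernel on `ℕ × ℕ`. -/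
noncomputable def fejerSum (g : ℕ → ℕ → ℂ) (N : ℕ) (t : ℝ) : ℂ :=
  ∑ m ∈ Finset.range N, ∑ n ∈ Finset.range N,
    g m n * Complex.exp (((m - n : ℤ) : ℂ) * t * Complex.I)

lemma continuous_fejerSum (g : ℕ → ℕ → ℂ) (N : ℕ) : Continuous (fejerSum g N) := by
  unfold fejerSum
  fun_prop

lemma intervalIntegral_fejerSum_mul_exp (g : ℕ → ℕ → ℂ) (N : ℕ) (k : ℤ) :
    ∫ t in (0 : ℝ)..2 * Real.pi, fejerSum g N t * Complex.exp (k * t * Complex.I) =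
      2 * Real.pi * ∑ m ∈ Finset.range N, ∑ n ∈ Finset.range N,
        if (m - n + k : ℤ) = 0 then g m n else 0 := by
  have h : ∀ t : ℝ, fejerSum g N t * Complex.exp (k * t * Complex.I) =
      ∑ m ∈ Finset.range N, ∑ n ∈ Finset.range N,
        g m n * Complex.exp (((m - n + k : ℤ) : ℂ) * t * Complex.I) := by
    intro t
    simp only [fejerSum, Finset.sum_mul]
    refine Finset.sum_congr rfl fun m _ => Finset.sum_congr rfl fun n _ => ?_
    rw [mul_assoc, ← Complex.exp_add]
    congr 2
    push_cast
    ring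
  simp_rw [h]
  rw [intervalIntegral.integral_finsetSum
    fun m _ => Continuous.intervalIntegrable (by fun_prop) _ _, Finset.mul_sum]
  refine Finset.sum_congr rfl fun m _ => ?_
  rw [intervalIntegral.integral_finsetSum
    fun n _ => Continuous.intervalIntegrable (by fun_prop) _ _, Finset.mul_sum]
  refine Finset.sum_congr rfl fun n _ => ?_
  rw [intervalIntegral.integral_const_mul, intervalIntegral_exp_int_mul_I]
  split_ifs <;> ring

/-- The measure on `[0, 2π]` whose density is the normalised Fejér sum of a kernel. -/
lemma exists_finiteMeasure_integral_exp_eq_fejer (g : ℕ → ℕ → ℂ) (N : ℕ)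
    (hpos : ∀ t, 0 ≤ fejerSum g N t) :
    ∃ μ : FiniteMeasure ℝ, μ (Set.Icc 0 (2 * Real.pi))ᶜ = 0 ∧
      ∀ k : ℤ, ∫ t : ℝ, Complex.exp (k * t * Complex.I) ∂(μ : Measure ℝ) =
        (N : ℂ)⁻¹ * ∑ m ∈ Finset.range N, ∑ n ∈ Finset.range N,
          if (m - n + k : ℤ) = 0 then g m n else 0 := by
  set d : ℝ → NNReal := fun t => Real.toNNReal ((2 * Real.pi * N)⁻¹ * (fejerSum g N t).re)
    with hd
  have hdc : Continuous d := by
    have := continuous_fejerSum g N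
    fun_prop
  have hd_coe : ∀ t, ((d t : ℝ) : ℂ) = (2 * Real.pi * N : ℂ)⁻¹ * fejerSum g N t := by
    intro t
    have h := Complex.nonneg_iff.1 (hpos t)
    rw [hd]
    simp only
    rw [Real.coe_toNNReal _ (mul_nonneg (by positivity) h.1)]
    have hre : fejerSum g N t = (fejerSum g N t).re :=
      Complex.ext rfl (by simpa using h.2.symm)
    rw [hre]
    push_cast
    simp
  set ν := (volume.restrict (Set.Icc 0 (2 * Real.pi))).withDensity fun t => (d t : ENNReal)
    with hν
  have hfin : IsFiniteMeasure ν := by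
    refine isFiniteMeasure_withDensity_ofReal (Integrable.hasFiniteIntegral ?_)
    have := continuous_fejerSum g N
    exact Continuous.integrableOn_Icc (by fun_prop)
  refine ⟨⟨ν, hfin⟩, ?_, fun k => ?_⟩
  · refine (FiniteMeasure.null_iff_toMeasure_null _ _).2 ?_
    refine withDensity_absolutelyContinuous _ _ ?_
    rw [Measure.restrict_apply measurableSet_Icc.compl]
    simp
  · change ∫ t : ℝ, Complex.exp (k * t * Complex.I) ∂ν = _
    rw [hν, integral_withDensity_eq_integral_smul hdc.measurable,
      integral_Icc_eq_integral_Ioc, ← intervalIntegral.integral_of_le (by positivity)]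
    have h : ∀ t : ℝ, d t • Complex.exp (k * t * Complex.I) =
        (2 * Real.pi * N : ℂ)⁻¹ * (fejerSum g N t * Complex.exp (k * t * Complex.I)) := by
      intro t
      rw [NNReal.smul_def, Complex.real_smul, hd_coe, mul_assoc]
    simp_rw [h]
    rw [intervalIntegral.integral_const_mul, intervalIntegral_fejerSum_mul_exp, mul_inv,
      ← mul_assoc]
    congr 1
    have : (2 * Real.pi : ℂ) ≠ 0 := by exact_mod_cast Real.two_pi_pos.ne'
    field_simp

lemma toeplitz_eq_of_add_eq {g : ℕ → ℕ → ℂ} (hg : ∀ m n, g (m + 1) (n + 1) = g m n)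
    {a b m n : ℕ} (h : m + b = n + a) : g m n = g a b := by
  have hshift : ∀ k m n, g (m + k) (n + k) = g m n := by
    intro k
    induction k with
    | zero => simp
    | succ k ih => exact fun m n => (hg _ _).trans (ih m n)
  rcases le_total a m with ham | ham
  · obtain ⟨k, rfl⟩ := Nat.exists_eq_add_of_le ham
    obtain rfl : n = b + k := by omega
    exact hshift k a b
  · obtain ⟨k, rfl⟩ := Nat.exists_eq_add_of_le ham
    obtain rfl : b = n + k := by omega
    exact (hshift k m n).symm

lemma exists_sum_toeplitz_eq_natCast_mul {g : ℕ → ℕ → ℂ}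
    (hg : ∀ m n, g (m + 1) (n + 1) = g m n) (a b N : ℕ) :
    ∃ c : ℕ, c ≤ N ∧ N ≤ c + (a + b) ∧
      (∑ m ∈ Finset.range N, ∑ n ∈ Finset.range N,
        if (m - n + (b - a : ℤ) : ℤ) = 0 then g m n else 0) = c * g a b := by
  set s := (Finset.range N).filter fun m => a ≤ m + b ∧ m + b - a < N
  refine ⟨s.card, (Finset.card_filter_le _ _).trans (by simp), ?_, ?_⟩
  · have hsub : Finset.Ico a (N - b) ⊆ s := fun m hm => by
      simp only [Finset.mem_Ico] at hm
      simp only [s, Finset.mem_filter, Finset.mem_range]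
      omega
    have := Finset.card_le_card hsub
    simp only [Nat.card_Ico] at this
    omega
  · rw [← nsmul_eq_mul, ← Finset.sum_const, Finset.sum_filter]
    refine Finset.sum_congr rfl fun m _ => ?_
    split_ifs with h
    · rw [Finset.sum_eq_single (m + b - a)]
      · rw [if_pos (by omega)]
        exact toeplitz_eq_of_add_eq hg (by omega)
      · exact fun n _ hn => if_neg (by omega)
      · exact fun hn => absurd (Finset.mem_range.2 h.2) hn
    · refine Finset.sum_eq_zero fun n hn => if_neg ?_
      rw [Finset.mem_range] at hn
      omega

/-- **Herglotz's theorem** for Toeplitz kernels on `ℕ × ℕ`. -/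
theorem exists_measure_of_toeplitz {g : ℕ → ℕ → ℂ}
    (hg : ∀ m n, g (m + 1) (n + 1) = g m n) (hpos : ∀ N t, 0 ≤ fejerSum g N t) :
    ∃ μ : FiniteMeasure ℝ, μ (Set.Icc 0 (2 * Real.pi))ᶜ = 0 ∧
      ∀ a b : ℕ, g a b = ∫ t : ℝ, Complex.exp ((b - a : ℤ) * t * Complex.I) ∂(μ : Measure ℝ) := by
  choose μ hμ0 hμ using fun N => exists_finiteMeasure_integral_exp_eq_fejer g N (hpos N)
  have hmass : ∀ N, (μ N).mass ≤ ‖g 0 0‖₊ := by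
    intro N
    obtain ⟨c, hcN, -, hc⟩ := exists_sum_toeplitz_eq_natCast_mul hg 0 0 N
    have h := hμ N 0
    simp only [Nat.cast_zero, sub_self] at hc
    rw [hc] at h
    have h1 : (((μ N).mass : ℝ) : ℂ) = (N : ℂ)⁻¹ * (c * g 0 0) := by
      rw [← h]
      simp only [Int.cast_zero, zero_mul, Complex.exp_zero, integral_const, Complex.real_smul,
        mul_one]
      rfl
    rw [← NNReal.coe_le_coe, coe_nnnorm]
    have h2 := congrArg norm h1
    rw [Complex.norm_real, Real.norm_of_nonneg (NNReal.coe_nonneg _)] at h2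
    rw [h2]
    simp only [norm_mul, norm_inv, Complex.norm_natCast, ← mul_assoc]
    refine mul_le_of_le_one_left (norm_nonneg _) ?_
    exact inv_mul_le_one_of_le₀ (by exact_mod_cast hcN) (by positivity)
  obtain ⟨ν, hν, hlim⟩ := (isCompact_setOfPred_finiteMeasure_le_of_isCompact ‖g 0 0‖₊
    (isCompact_Icc (a := (0 : ℝ)) (b := 2 * Real.pi))).ultrafilter_le_nhds
    ((hyperfilter ℕ).map μ) (by
      rw [le_principal_iff, Ultrafilter.mem_coe, Ultrafilter.mem_map]
      exact Filter.mem_of_superset univ_mem fun N _ => ⟨hmass N, hμ0 N⟩)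
  refine ⟨ν, hν.2, fun a b => ?_⟩
  have hlim' : Tendsto μ (hyperfilter ℕ) (𝓝 ν) := hlim
  rw [FiniteMeasure.tendsto_iff_forall_integral_rclike_tendsto ℂ] at hlim'
  have hint := hlim' (BoundedContinuousFunction.ofNormedAddCommGroup
    (fun t : ℝ => Complex.exp ((b - a : ℤ) * t * Complex.I)) (by fun_prop) 1 fun t => by
      rw [← Complex.ofReal_intCast, ← Complex.ofReal_mul, Complex.norm_exp_ofReal_mul_I])
  simp only [BoundedContinuousFunction.coe_ofNormedAddCommGroup] at hint
  refine tendsto_nhds_unique (Tendsto.mono_left ?_ Nat.hyperfilter_le_atTop) hint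
  simp_rw [hμ]
  choose c hcN hNc hc using exists_sum_toeplitz_eq_natCast_mul hg a b
  simp_rw [hc, ← mul_assoc]
  nth_rewrite 2 [← one_mul (g a b)]
  refine Tendsto.mul_const _ ?_
  have hreal : Tendsto (fun N : ℕ => (N : ℝ)⁻¹ * c N) atTop (𝓝 1) := by
    have hlow : Tendsto (fun N : ℕ => 1 - (a + b : ℝ) * (N : ℝ)⁻¹) atTop (𝓝 1) := by
      simpa using (tendsto_inv_atTop_nhds_zero_nat (𝕜 := ℝ)).const_mul (a + b : ℝ)
        |>.const_sub 1
    refine tendsto_of_tendsto_of_tendsto_of_le_of_le' hlow tendsto_const_nhds ?_ ?_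
    · filter_upwards [eventually_gt_atTop 0] with N hN
      have h1 : (N : ℝ) ≤ c N + (a + b) := by exact_mod_cast hNc N
      have h2 : (0 : ℝ) < N := by exact_mod_cast hN
      field_simp
      linarith
    · filter_upwards with N
      exact inv_mul_le_one_of_le₀ (by exact_mod_cast hcN N) (by positivity)
  simpa [Function.comp_def] using (Complex.continuous_ofReal.tendsto 1).comp hreal

end Herglotz

section KernelForm

/-- The bilinear form on polynomials whose value at `(X ^ m, X ^ n)` is `f m n`. -/
noncomputable def kernelForm (f : ℕ → ℕ → ℂ) : ℂ[X] →ₗ[ℂ] ℂ[X] →ₗ[ℂ] ℂ :=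
  (basisMonomials ℂ).constr ℂ fun m => (basisMonomials ℂ).constr ℂ (f m)

lemma kernelForm_monomial (f : ℕ → ℕ → ℂ) (m n : ℕ) (a b : ℂ) :
    kernelForm f (monomial m a) (monomial n b) = a * (b * f m n) := by
  have h1 : ∀ (k : ℕ) (c : ℂ), monomial k c = c • basisMonomials ℂ k := by
    intro k c
    simp [smul_monomial]
  rw [h1, h1, map_smul, map_smul, LinearMap.smul_apply, kernelForm, Module.Basis.constr_basis,
    Module.Basis.constr_basis, smul_eq_mul, smul_eq_mul]
  ring

lemma kernelForm_X_pow (f : ℕ → ℕ → ℂ) (m n : ℕ) :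
    kernelForm f (X ^ m) (X ^ n) = f m n := by
  simp [X_pow_eq_monomial, kernelForm_monomial]

lemma kernelForm_discreteAnalytic {f : ℕ → ℕ → ℂ}
    (hda : ∀ m n : ℕ,
      f m n + Complex.I * f (m + 1) n - Complex.I * f m (n + 1) - f (m + 1) (n + 1) = 0)
    (p q : ℂ[X]) :
    kernelForm f p q + Complex.I * kernelForm f (X * p) q - Complex.I * kernelForm f p (X * q)
      - kernelForm f (X * p) (X * q) = 0 := by
  induction p using Polynomial.induction_on' with
  | add p p' hp hp' =>
    simp only [mul_add, map_add, LinearMap.add_apply]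
    linear_combination hp + hp'
  | monomial m a =>
    induction q using Polynomial.induction_on' with
    | add q q' hq hq' =>
      simp only [mul_add, map_add]
      linear_combination hq + hq'
    | monomial n b =>
      simp only [X_mul_monomial, kernelForm_monomial]
      linear_combination a * b * hda m n

lemma ofReal_sqrt_two_sq : (Real.sqrt 2 : ℂ) ^ 2 = 2 := by
  rw [← Complex.ofReal_pow, Real.sq_sqrt zero_le_two, Complex.ofReal_ofNat]

lemma ofReal_sqrt_two_ne_zero : (Real.sqrt 2 : ℂ) ≠ 0 := by
  simp

/-- The polynomial `(X - c) / √2`. -/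
noncomputable def unimodularPoly (c : ℂ) : ℂ[X] := C (Real.sqrt 2 : ℂ)⁻¹ * (X - C c)

lemma unimodularPoly_mul (c : ℂ) (p : ℂ[X]) :
    unimodularPoly c * p = (Real.sqrt 2 : ℂ)⁻¹ • (X * p - c • p) := by
  rw [unimodularPoly, smul_eq_C_mul, smul_eq_C_mul]
  ring

lemma X_mul_eq_unimodularPoly (c : ℂ) (p : ℂ[X]) :
    X * p = (Real.sqrt 2 : ℂ) • (unimodularPoly c * p) + c • p := by
  rw [unimodularPoly_mul, smul_smul, mul_inv_cancel₀ ofReal_sqrt_two_ne_zero]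
  simp

lemma map_conj_unimodularPoly (c : ℂ) :
    (unimodularPoly c).map (starRingEnd ℂ) = unimodularPoly (starRingEnd ℂ c) := by
  simp [unimodularPoly]

lemma kernelForm_unimodularPoly_mul {f : ℕ → ℕ → ℂ}
    (hda : ∀ m n : ℕ,
      f m n + Complex.I * f (m + 1) n - Complex.I * f m (n + 1) - f (m + 1) (n + 1) = 0)
    (p q : ℂ[X]) :
    kernelForm f (unimodularPoly (-Complex.I) * p) (unimodularPoly Complex.I * q) =
      kernelForm f p q := by
  have h := kernelForm_discreteAnalytic hda p q
  simp only [unimodularPoly_mul, map_smul, map_sub, LinearMap.smul_apply, LinearMap.sub_apply,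
    smul_eq_mul]
  have hs := ofReal_sqrt_two_sq
  have hs0 := ofReal_sqrt_two_ne_zero
  field_simp
  rw [hs]
  linear_combination -h - kernelForm f p q * Complex.I_sq

lemma kernelForm_map_conj_nonneg {f : ℕ → ℕ → ℂ}
    (hf : ∀ N : ℕ, (Matrix.of fun m n : Fin (N + 1) => f m n).PosSemidef) (p : ℂ[X]) :
    0 ≤ kernelForm f (p.map (starRingEnd ℂ)) p := by
  have h := (Matrix.posSemidef_iff_dotProduct_mulVec.1 (hf p.natDegree)).2 fun i => p.coeff i
  have hp : kernelForm f (p.map (starRingEnd ℂ)) p =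
      ∑ i ∈ Finset.range (p.natDegree + 1), ∑ j ∈ Finset.range (p.natDegree + 1),
        star (p.coeff i) * (f i j * p.coeff j) := by
    conv_lhs => rw [p.as_sum_range]
    simp only [Polynomial.map_sum, map_monomial, map_sum, LinearMap.sum_apply,
      kernelForm_monomial]
    rw [Finset.sum_comm]
    refine Finset.sum_congr rfl fun i _ => Finset.sum_congr rfl fun j _ => ?_
    rw [mul_comm (p.coeff j)]
    rfl
  rw [hp]
  simpa only [dotProduct, Matrix.mulVec, Matrix.of_apply, Pi.star_apply, Finset.mul_sum,
    Finset.sum_range] using h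

lemma fejerSum_kernelForm (f : ℕ → ℕ → ℂ) (N : ℕ) (t : ℝ) :
    fejerSum (fun m n => kernelForm f (unimodularPoly (-Complex.I) ^ m)
        (unimodularPoly Complex.I ^ n)) N t =
      kernelForm f
        ((∑ n ∈ Finset.range N, Complex.exp (-n * t * Complex.I) •
          unimodularPoly Complex.I ^ n).map (starRingEnd ℂ))
        (∑ n ∈ Finset.range N, Complex.exp (-n * t * Complex.I) •
          unimodularPoly Complex.I ^ n) := by
  simp only [fejerSum, Polynomial.map_sum, Polynomial.map_smul, Polynomial.map_pow,
    map_conj_unimodularPoly, Complex.conj_I, map_sum, LinearMap.sum_apply, map_smul,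
    LinearMap.smul_apply, smul_eq_mul, ← Complex.exp_conj, Finset.mul_sum]
  rw [Finset.sum_comm]
  refine Finset.sum_congr rfl fun n _ => Finset.sum_congr rfl fun m _ => ?_
  have h : Complex.exp (((m - n : ℤ) : ℂ) * t * Complex.I) =
      Complex.exp (-n * t * Complex.I) *
        Complex.exp (starRingEnd ℂ (-m * t * Complex.I)) := by
    rw [← Complex.exp_add]
    congr 1
    simp
    ring
  rw [h]
  ring

end KernelForm

section Moments

variable (μ : Measure ℝ)

/-- The mixed moments of `e^{it}` and `√2 e^{it} + i`. -/
noncomputable def mixedMoment (a b m n : ℕ) : ℂ :=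
  ∫ t : ℝ, Complex.exp ((b - a : ℤ) * t * Complex.I) *
    (((Real.sqrt 2 : ℂ) * Complex.exp (-(t : ℂ) * Complex.I) - Complex.I) ^ m *
      ((Real.sqrt 2 : ℂ) * Complex.exp ((t : ℂ) * Complex.I) + Complex.I) ^ n) ∂μ

variable {μ} [IsFiniteMeasure μ]

lemma integrable_of_continuous_of_compl_Icc {φ : ℝ → ℂ} (hφ : Continuous φ)
    (hμ : μ (Set.Icc 0 (2 * Real.pi))ᶜ = 0) : Integrable φ μ := by
  rw [← Measure.restrict_eq_self_of_ae_mem (s := Set.Icc 0 (2 * Real.pi)) hμ]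
  exact hφ.integrableOn_Icc

lemma mixedMoment_succ_left (hμ : μ (Set.Icc 0 (2 * Real.pi))ᶜ = 0) (a b m n : ℕ) :
    mixedMoment μ a b (m + 1) n =
      (Real.sqrt 2 : ℂ) * mixedMoment μ (a + 1) b m n - Complex.I * mixedMoment μ a b m n := by
  simp only [mixedMoment]
  rw [← integral_const_mul, ← integral_const_mul, ← integral_sub
    (integrable_of_continuous_of_compl_Icc (by fun_prop) hμ)
    (integrable_of_continuous_of_compl_Icc (by fun_prop) hμ)]
  refine integral_congr_ae (ae_of_all _ fun t => ?_)
  have h : Complex.exp ((b - (a + 1 : ℕ) : ℤ) * t * Complex.I) =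
      Complex.exp ((b - a : ℤ) * t * Complex.I) * Complex.exp (-(t : ℂ) * Complex.I) := by
    rw [← Complex.exp_add]
    congr 1
    push_cast
    ring
  simp only [h]
  ring

lemma mixedMoment_succ_right (hμ : μ (Set.Icc 0 (2 * Real.pi))ᶜ = 0) (a b m n : ℕ) :
    mixedMoment μ a b m (n + 1) =
      (Real.sqrt 2 : ℂ) * mixedMoment μ a (b + 1) m n + Complex.I * mixedMoment μ a b m n := by
  simp only [mixedMoment]
  rw [← integral_const_mul, ← integral_const_mul, ← integral_add
    (integrable_of_continuous_of_compl_Icc (by fun_prop) hμ)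
    (integrable_of_continuous_of_compl_Icc (by fun_prop) hμ)]
  refine integral_congr_ae (ae_of_all _ fun t => ?_)
  have h : Complex.exp (((b + 1 : ℕ) - a : ℤ) * t * Complex.I) =
      Complex.exp ((b - a : ℤ) * t * Complex.I) * Complex.exp ((t : ℂ) * Complex.I) := by
    rw [← Complex.exp_add]
    congr 1
    push_cast
    ring
  simp only [h]
  ring

lemma kernelForm_eq_mixedMoment {f : ℕ → ℕ → ℂ} (hμ : μ (Set.Icc 0 (2 * Real.pi))ᶜ = 0)
    (hf : ∀ a b : ℕ, kernelForm f (unimodularPoly (-Complex.I) ^ a)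
      (unimodularPoly Complex.I ^ b) = mixedMoment μ a b 0 0) (a b m n : ℕ) :
    kernelForm f (X ^ m * unimodularPoly (-Complex.I) ^ a) (X ^ n * unimodularPoly Complex.I ^ b) =
      mixedMoment μ a b m n := by
  induction m generalizing a with
  | zero =>
    induction n generalizing b with
    | zero => simpa using hf a b
    | succ n ih =>
      rw [pow_succ', mul_assoc, X_mul_eq_unimodularPoly Complex.I, mul_left_comm, ← pow_succ',
        map_add, map_smul, map_smul, ih, ih, mixedMoment_succ_right hμ, smul_eq_mul, smul_eq_mul]
  | succ m ih =>
    rw [pow_succ' X m, mul_assoc, X_mul_eq_unimodularPoly (-Complex.I), mul_left_comm,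
      ← pow_succ' (unimodularPoly _), map_add, map_smul, map_smul, LinearMap.add_apply,
      LinearMap.smul_apply, LinearMap.smul_apply, ih, ih, mixedMoment_succ_left hμ, smul_eq_mul,
      smul_eq_mul]
    ring

lemma sum_star_mul_dafMoment_nonneg (hμ : μ (Set.Icc 0 (2 * Real.pi))ᶜ = 0) (N : ℕ)
    (x : Fin N → ℂ) : 0 ≤ ∑ m : Fin N, ∑ n : Fin N, star (x m) * (dafMoment μ m n * x n) := by
  set φ : ℝ → ℂ := fun t => ∑ n : Fin N,
    ((Real.sqrt 2 : ℂ) * Complex.exp ((t : ℂ) * Complex.I) + Complex.I) ^ (n : ℕ) * x n with hφ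
  have h : ∑ m : Fin N, ∑ n : Fin N, star (x m) * (dafMoment μ m n * x n) =
      ∫ t, star (φ t) * φ t ∂μ := by
    simp only [hφ, star_sum, Finset.sum_mul_sum]
    rw [integral_finsetSum _ fun m _ =>
      integrable_of_continuous_of_compl_Icc (by fun_prop) hμ]
    refine Finset.sum_congr rfl fun m _ => ?_
    rw [integral_finsetSum _ fun n _ =>
      integrable_of_continuous_of_compl_Icc (by fun_prop) hμ]
    refine Finset.sum_congr rfl fun n _ => ?_
    rw [dafMoment, ← integral_mul_const, ← integral_const_mul]
    refine integral_congr_ae (ae_of_all _ fun t => ?_)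
    simp only [star_mul', star_pow, RCLike.star_def, map_add, map_mul, Complex.conj_I,
      Complex.conj_ofReal, ← Complex.exp_conj, mul_neg, neg_mul, ← sub_eq_add_neg]
    ring
  rw [h]
  exact integral_nonneg fun t => star_mul_self_nonneg _

end Moments

/-- A symmetric discrete analytic function on the quarter plane has all its finite
sections positive semidefinite iff it is given by the moments of a finite positive
measure on `[0, 2π]`. -/
theorem posSemidef_sections_iff_exists_measure (f : ℕ → ℕ → ℂ)
    (hda : ∀ m n : ℕ,
      f m n + Complex.I * f (m + 1) n - Complex.I * f m (n + 1) - f (m + 1) (n + 1) = 0)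
    (hsym : ∀ m n : ℕ, f m n = starRingEnd ℂ (f n m)) :
    (∀ N : ℕ, (Matrix.of fun m n : Fin (N + 1) => f m n).PosSemidef) ↔
      ∃ μ : Measure ℝ, IsFiniteMeasure μ ∧ μ (Set.Icc 0 (2 * Real.pi))ᶜ = 0 ∧
        ∀ m n : ℕ, f m n = dafMoment μ m n := by
  constructor
  · intro hf
    obtain ⟨μ, hμ, hg⟩ := exists_measure_of_toeplitz
      (g := fun a b => kernelForm f (unimodularPoly (-Complex.I) ^ a) (unimodularPoly Complex.I ^ b))
      (fun m n => by simp only [pow_succ', kernelForm_unimodularPoly_mul hda])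
      (fun N t => (fejerSum_kernelForm f N t).symm ▸ kernelForm_map_conj_nonneg hf _)
    rw [FiniteMeasure.null_iff_toMeasure_null] at hμ
    refine ⟨μ, inferInstance, hμ, fun m n => ?_⟩
    have h := kernelForm_eq_mixedMoment (f := f) hμ
      (fun a b => by simpa [mixedMoment] using hg a b) 0 0 m n
    simpa [mixedMoment, dafMoment, kernelForm_X_pow] using h
  · rintro ⟨μ, hfin, hμ, hf⟩ N
    refine Matrix.posSemidef_iff_dotProduct_mulVec.2 ⟨?_, fun x => ?_⟩
    · ext m n
      exact (hsym m n).symm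
    · have h := sum_star_mul_dafMoment_nonneg hμ (N + 1) x
      simpa only [dotProduct, Matrix.mulVec, Matrix.of_apply, Pi.star_apply, Finset.mul_sum, hf]
        using h
end

section
/- Let μ be a finite positive Borel measure on ℝ supported in [0, 2π]. Define f(m,n) = ∫ (√2·e^{-it} - i)^m · (√2·e^{it} + i)^n dμ(t) for m,n ∈ ℕ, and M_j = ∫ e^{-ijt} dμ(t) for j ∈ ℤ. Fix N ∈ ℕ and let F_N be the (N+1)×(N+1) matrix with entries (F_N)_{m,n} = f(m,n), let T_N be the (N+1)×(N+1) Toeplitz matrix with entries (T_N)_{m,n} = M_{m-n}, and let L_N be the (N+1)×(N+1) lower triangular matrix with entries (L_N)_{m,k} = 2^{-m/2} · binom(m,k) · i^{m-k} for 0 ≤ k ≤ m and (L_N)_{m,k} = 0 for k > m. Then T_N = L_N · F_N · L_N*, where L_N* is the conjugate transpose of L_N. -/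
open MeasureTheory Matrix

/-- A continuous function is integrable against a finite measure carried by a compact interval. -/
theorem Continuous.integrable_of_measure_compl_Icc_eq_zero {μ : Measure ℝ} [IsFiniteMeasure μ]
    {a b : ℝ} (hμ : μ (Set.Icc a b)ᶜ = 0) {g : ℝ → ℂ} (hg : Continuous g) : Integrable g μ := by
  have hres : μ.restrict (Set.Icc a b) = μ :=
    Measure.restrict_eq_self_of_ae_mem (mem_ae_iff.2 hμ)
  rw [← hres]
  exact hg.integrableOn_Icc

/-- The binomial theorem for a normalized row of binomial coefficients, padded with zeros. -/
theorem sum_fin_ite_choose_mul_pow {N m : ℕ} (hm : m < N + 1) (c a x : ℂ) :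
    ∑ k : Fin (N + 1), (if (k : ℕ) ≤ m then (c ^ m)⁻¹ * (m.choose k : ℂ) * a ^ (m - (k : ℕ)) else 0)
      * x ^ (k : ℕ) = (c ^ m)⁻¹ * (x + a) ^ m := by
  rw [Fin.sum_univ_eq_sum_range (fun k ↦ (if k ≤ m then (c ^ m)⁻¹ * (m.choose k : ℂ) * a ^ (m - k)
    else 0) * x ^ k) (N + 1), add_pow, Finset.mul_sum]
  symm
  apply Finset.sum_subset_zero_on_sdiff (Finset.range_mono hm)
  · intro k hk
    have hkm : ¬ k ≤ m := by
      have := (Finset.mem_sdiff.1 hk).2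
      rw [Finset.mem_range] at this
      omega
    simp [hkm]
  · intro k hk
    have hkm : k ≤ m := Nat.lt_succ_iff.1 (Finset.mem_range.1 hk)
    rw [if_pos hkm]
    ring

/-- If the integrals of `u k * v l` form a matrix `F`, then `A * F * B` is formed by the integrals
of the products of the corresponding linear combinations. -/
theorem Matrix.mul_mul_apply_eq_integral {ι : Type*} [Fintype ι] {μ : Measure ℝ}
    {u v : ι → ℝ → ℂ} {F : Matrix ι ι ℂ} (hF : ∀ k l, F k l = ∫ t, u k t * v l t ∂μ)
    (hint : ∀ k l, Integrable (fun t ↦ u k t * v l t) μ) (A B : Matrix ι ι ℂ) (m n : ι) :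
    (A * F * B) m n = ∫ t, (∑ k, A m k * u k t) * (∑ l, B l n * v l t) ∂μ := by
  have hexp : ∀ t, (∑ k, A m k * u k t) * (∑ l, B l n * v l t) =
      ∑ l, ∑ k, A m k * B l n * (u k t * v l t) := by
    intro t
    rw [Finset.sum_mul_sum, Finset.sum_comm]
    refine Finset.sum_congr rfl fun l _ ↦ Finset.sum_congr rfl fun k _ ↦ by ring
  simp_rw [hexp]
  rw [integral_finsetSum _ fun l _ ↦ integrable_finsetSum _ fun k _ ↦ (hint k l).const_mul _]
  simp_rw [integral_finsetSum Finset.univ fun k _ ↦ (hint k _).const_mul _, integral_const_mul,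
    Matrix.mul_apply, hF, Finset.sum_mul]
  refine Finset.sum_congr rfl fun l _ ↦ Finset.sum_congr rfl fun k _ ↦ by ring

/-- The Toeplitz matrix of trigonometric moments equals `L_N F_N L_N^*`, where `F_N` is
the matrix of discrete analytic moments and `L_N` the lower triangular binomial matrix. -/
theorem toeplitz_eq_L_mul_F_mul_Lstar (μ : Measure ℝ) [IsFiniteMeasure μ]
    (hsupp : μ (Set.Icc 0 (2 * Real.pi))ᶜ = 0) (N : ℕ)
    (F T L : Matrix (Fin (N + 1)) (Fin (N + 1)) ℂ)
    (hF : ∀ m n : Fin (N + 1), F m n =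
      ∫ t : ℝ, ((Real.sqrt 2 : ℂ) * Complex.exp (-(t : ℂ) * Complex.I) - Complex.I) ^ (m : ℕ) *
        ((Real.sqrt 2 : ℂ) * Complex.exp ((t : ℂ) * Complex.I) + Complex.I) ^ (n : ℕ) ∂μ)
    (hT : ∀ m n : Fin (N + 1), T m n =
      ∫ t : ℝ, Complex.exp (-((((m : ℕ) : ℤ) - ((n : ℕ) : ℤ) : ℤ) : ℂ) * (t : ℂ) * Complex.I) ∂μ)
    (hL : ∀ m k : Fin (N + 1), L m k =
      if (k : ℕ) ≤ (m : ℕ) then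
        ((Real.sqrt 2 : ℂ) ^ (m : ℕ))⁻¹ * ((m : ℕ).choose (k : ℕ) : ℂ) *
          Complex.I ^ ((m : ℕ) - (k : ℕ))
      else 0) :
    T = L * F * Lᴴ := by
  ext m n
  rw [Matrix.mul_mul_apply_eq_integral hF
    (fun k l ↦ Continuous.integrable_of_measure_compl_Icc_eq_zero hsupp (by fun_prop)), hT]
  have hc : (Real.sqrt 2 : ℂ) ≠ 0 := by simp
  have hLstar : ∀ l, Lᴴ l n = if (l : ℕ) ≤ (n : ℕ) then
      ((Real.sqrt 2 : ℂ) ^ (n : ℕ))⁻¹ * ((n : ℕ).choose (l : ℕ) : ℂ) *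
        (-Complex.I) ^ ((n : ℕ) - (l : ℕ)) else 0 := by
    intro l
    rw [Matrix.conjTranspose_apply, hL]
    split_ifs <;> simp
  congr 1 with t
  simp_rw [hL, hLstar]
  rw [sum_fin_ite_choose_mul_pow m.isLt, sum_fin_ite_choose_mul_pow n.isLt, sub_add_cancel,
    add_neg_cancel_right, mul_pow, mul_pow, inv_mul_cancel_left₀ (pow_ne_zero _ hc),
    inv_mul_cancel_left₀ (pow_ne_zero _ hc), ← Complex.exp_nat_mul, ← Complex.exp_nat_mul,
    ← Complex.exp_add]
  congr 1
  push_cast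
  ring
end

section
/- Let A ∈ ℂ^{N×N}, C ∈ ℂ^{p×N}, B ∈ ℂ^{N×q}, and assume that A and I_N + i·A are both invertible, that the pair (C,A) is observable, and that the pair (A,B) is controllable. Then the pair (C·(I_N + i·A)⁻¹, A⁻¹) is observable and the pair (A⁻¹, A⁻¹·B) is controllable. -/
open Matrix

open Polynomial in
/-- The inverse of an invertible matrix over a field is a polynomial in that matrix. -/
theorem Matrix.inv_mem_adjoin_singleton {K n : Type*} [Field K] [Fintype n] [DecidableEq n]
    {M : Matrix n n K} (hM : IsUnit M) : M⁻¹ ∈ Algebra.adjoin K {M} := by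
  have hdet : IsUnit M.det := (isUnit_iff_isUnit_det M).mp hM
  have hc : M.charpoly.coeff 0 ≠ 0 := by
    intro h
    have h' := det_eq_sign_charpoly_coeff M
    rw [h, mul_zero] at h'
    exact hdet.ne_zero h'
  have hroot : M * aeval M M.charpoly.divX + algebraMap K _ (M.charpoly.coeff 0) = 0 := by
    have h := aeval_self_charpoly M
    rwa [← X_mul_divX_add M.charpoly, map_add, map_mul, aeval_X, aeval_C] at h
  have hinv : M⁻¹ = (-(M.charpoly.coeff 0)⁻¹) • aeval M M.charpoly.divX := by
    refine inv_eq_right_inv ?_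
    rw [mul_smul_comm, eq_neg_of_add_eq_zero_left hroot, Algebra.algebraMap_eq_smul_one,
      smul_neg, neg_smul, neg_neg, smul_smul, inv_mul_cancel₀ hc, one_smul]
  rw [hinv]
  exact Subalgebra.smul_mem _ (aeval_mem_adjoin_singleton K M) _

/-- A subspace of an algebra which contains every power of `a` contains every polynomial in `a`. -/
theorem Submodule.mem_of_mem_adjoin_singleton {R S : Type*} [CommSemiring R] [Semiring S]
    [Algebra R S] {a : S} {W : Submodule R S} (hW : ∀ n : ℕ, a ^ n ∈ W) {x : S}
    (hx : x ∈ Algebra.adjoin R {a}) : x ∈ W := by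
  rw [Algebra.adjoin_singleton_eq_range_aeval] at hx
  obtain ⟨f, rfl⟩ := hx
  change Polynomial.aeval a f ∈ W
  rw [Polynomial.aeval_eq_sum_range]
  exact W.sum_mem fun n _ => W.smul_mem _ (hW n)

/-- If `(C,A)` is observable, `(A,B)` is controllable, and `A` and `I + iA` are invertible,
then `(C (I + iA)⁻¹, A⁻¹)` is observable and `(A⁻¹, A⁻¹ B)` is controllable. -/
theorem minimal_triple_inverse {N p q : ℕ}
    (A : Matrix (Fin N) (Fin N) ℂ) (C : Matrix (Fin p) (Fin N) ℂ) (B : Matrix (Fin N) (Fin q) ℂ)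
    (hA : IsUnit A) (hiA : IsUnit ((1 : Matrix (Fin N) (Fin N) ℂ) + Complex.I • A))
    (hobs : ∀ x : Fin N → ℂ, (∀ n : ℕ, C.mulVec ((A ^ n).mulVec x) = 0) → x = 0)
    (hctrl : Submodule.span ℂ
      {v : Fin N → ℂ | ∃ (n : ℕ) (j : Fin q), v = fun i => (A ^ n * B) i j} = ⊤) :
    (∀ x : Fin N → ℂ,
      (∀ n : ℕ,
        (C * ((1 : Matrix (Fin N) (Fin N) ℂ) + Complex.I • A)⁻¹).mulVec
          ((A⁻¹ ^ n).mulVec x) = 0) → x = 0) ∧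
    Submodule.span ℂ
      {v : Fin N → ℂ | ∃ (n : ℕ) (j : Fin q), v = fun i => (A⁻¹ ^ n * (A⁻¹ * B)) i j} = ⊤ := by
  have hA' : A ∈ Algebra.adjoin ℂ {A⁻¹} := by
    have h := inv_mem_adjoin_singleton (isUnit_nonsing_inv_iff.mpr hA)
    rwa [nonsing_inv_nonsing_inv A ((isUnit_iff_isUnit_det A).mp hA)] at h
  constructor
  · intro x hx
    set K : Matrix (Fin N) (Fin N) ℂ := 1 + Complex.I • A with hK
    let f : Matrix (Fin N) (Fin N) ℂ →ₗ[ℂ] (Fin p → ℂ) :=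
      (C * K⁻¹).mulVecLin ∘ₗ (mulVecBilin ℂ ℂ).flip x
    have hf : ∀ M, f M = (C * K⁻¹) *ᵥ (M *ᵥ x) := fun M => rfl
    refine hobs x fun n => ?_
    have hmem : K * A ^ n ∈ Algebra.adjoin ℂ {A⁻¹} :=
      mul_mem (add_mem (one_mem _) (Subalgebra.smul_mem _ hA' _)) (pow_mem hA' n)
    have h : f (K * A ^ n) = 0 := LinearMap.mem_ker.mp <|
      Submodule.mem_of_mem_adjoin_singleton (W := LinearMap.ker f)
        (fun m => LinearMap.mem_ker.mpr (hx m)) hmem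
    rw [hf, mulVec_mulVec, Matrix.mul_assoc, ← Matrix.mul_assoc K⁻¹,
      nonsing_inv_mul K ((isUnit_iff_isUnit_det K).mp hiA), Matrix.one_mul] at h
    rw [mulVec_mulVec, h]
  · rw [eq_top_iff, ← hctrl, Submodule.span_le]
    rintro v ⟨n, j, rfl⟩
    let g : Matrix (Fin N) (Fin N) ℂ →ₗ[ℂ] (Fin N → ℂ) :=
      (mulVecBilin ℂ ℂ).flip fun i => (A⁻¹ * B) i j
    have hg : ∀ M, g M = fun i => (M * (A⁻¹ * B)) i j := fun M => rfl
    have h := Submodule.mem_of_mem_adjoin_singleton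
      (W := (Submodule.span ℂ {v : Fin N → ℂ | ∃ (n : ℕ) (j : Fin q),
        v = fun i => (A⁻¹ ^ n * (A⁻¹ * B)) i j}).comap g)
      (fun m => Submodule.subset_span ⟨m, j, hg _⟩) (mul_mem (pow_mem hA' n) hA')
    rw [Submodule.mem_comap, hg, Matrix.mul_assoc, ← Matrix.mul_assoc A,
      mul_nonsing_inv A ((isUnit_iff_isUnit_det A).mp hA), Matrix.one_mul] at h
    exact h
end

section
/- Let A, H ∈ ℂ^{N×N} with H Hermitian and invertible and A·H⁻¹·A* = H⁻¹; let D ∈ ℂ^{p×p} and C ∈ ℂ^{p×N} satisfy D + D* = -C·H⁻¹·C*, and set B = -A·H⁻¹·C*. Define φ(λ) = D + C·(λ·I_N - A)⁻¹·B. Then: (1) for all λ, ν ∈ ℂ such that λ·I_N - A and ν·I_N - A are invertible, φ(λ) + (φ(ν))* = (1 - λ·conj(ν)) · C·(λ·I_N - A)⁻¹·H⁻¹·(conj(ν)·I_N - A*)⁻¹·C*; and (2) for all λ such that A - λ·I_N is invertible, φ(λ) = (D - D*)/2 + (1/2)·C·(A + λ·I_N)·(A - λ·I_N)⁻¹·H⁻¹·C*.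 -/
open Matrix

/-- The resolvent identity behind the kernel factorization, for `A * K * A' = K`. -/
theorem resolvent_sum_of_mul_mul_eq {n : Type*} [Fintype n] [DecidableEq n]
    {A A' K R S : Matrix n n ℂ} {l m : ℂ} (hK : A * K * A' = K)
    (hR : R * (l • 1 - A) = 1) (hS : (m • 1 - A') * S = 1) :
    K + R * A * K + K * A' * S = -((1 - l * m) • (R * K * S)) := by
  have hR' : l • R = 1 + R * A := by
    rw [← hR, mul_sub, mul_smul_comm, mul_one, sub_add_cancel]
  have hS' : m • S = 1 + A' * S := by
    rw [← hS, sub_mul, smul_mul_assoc, one_mul, sub_add_cancel]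
  have hprod : (l * m) • (R * K * S) = (1 + R * A) * K * (1 + A' * S) := by
    rw [← hR', ← hS', smul_mul_assoc, smul_mul_assoc, mul_smul_comm, smul_smul]
  have hmid : R * A * K * (A' * S) = R * K * S := by
    calc R * A * K * (A' * S) = R * (A * K * A') * S := by noncomm_ring
      _ = R * K * S := by rw [hK]
  rw [sub_smul, one_smul, hprod, add_mul, add_mul, mul_add, mul_add, hmid]
  noncomm_ring

/-- The Cayley-type expression `(A + l) (A - l)⁻¹` in terms of the resolvent. -/
theorem add_smul_one_mul_inv_sub_smul_one {n : Type*} [Fintype n] [DecidableEq n]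
    {A : Matrix n n ℂ} {l : ℂ} (h : IsUnit (A - l • (1 : Matrix n n ℂ))) :
    (A + l • 1) * (A - l • 1)⁻¹ = -1 - (2 : ℂ) • ((l • 1 - A)⁻¹ * A) := by
  have hdet := (Matrix.isUnit_iff_isUnit_det _).mp h
  have hneg : (l • 1 - A)⁻¹ = -(A - l • 1)⁻¹ := by
    refine Matrix.inv_eq_left_inv ?_
    rw [← neg_sub A, neg_mul_neg, Matrix.nonsing_inv_mul _ hdet]
  have hl := Matrix.nonsing_inv_mul _ hdet
  have hr := Matrix.mul_nonsing_inv _ hdet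
  rw [hneg]
  generalize (A - l • 1)⁻¹ = R at hl hr ⊢
  simp only [mul_sub, sub_mul, add_mul, mul_smul_comm, smul_mul_assoc, mul_one, one_mul,
    neg_mul, smul_neg, sub_neg_eq_add, sub_eq_iff_eq_add] at hl hr ⊢
  rw [hl, hr]
  module

/-- For a realization `φ(λ) = D + C (λI - A)⁻¹ B` with `A` `H`-unitary,
`B = -A H⁻¹ C*` and `D + D* = -C H⁻¹ C*`, one has the kernel factorization
and the symmetric realization formula. -/
theorem H_unitary_realization_identities {N p : ℕ}
    (A H : Matrix (Fin N) (Fin N) ℂ) (hH : H.IsHermitian) (hHu : IsUnit H)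
    (hAH : A * H⁻¹ * Aᴴ = H⁻¹)
    (D : Matrix (Fin p) (Fin p) ℂ) (C : Matrix (Fin p) (Fin N) ℂ)
    (hD : D + Dᴴ = -(C * H⁻¹ * Cᴴ))
    (B : Matrix (Fin N) (Fin p) ℂ) (hB : B = -(A * H⁻¹ * Cᴴ))
    (φ : ℂ → Matrix (Fin p) (Fin p) ℂ)
    (hφ : ∀ l : ℂ, φ l = D + C * (l • (1 : Matrix (Fin N) (Fin N) ℂ) - A)⁻¹ * B) :
    (∀ l v : ℂ, IsUnit (l • (1 : Matrix (Fin N) (Fin N) ℂ) - A) →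
      IsUnit (v • (1 : Matrix (Fin N) (Fin N) ℂ) - A) →
      φ l + (φ v)ᴴ =
        (1 - l * starRingEnd ℂ v) •
          (C * (l • (1 : Matrix (Fin N) (Fin N) ℂ) - A)⁻¹ * H⁻¹ *
            (starRingEnd ℂ v • (1 : Matrix (Fin N) (Fin N) ℂ) - Aᴴ)⁻¹ * Cᴴ)) ∧
    (∀ l : ℂ, IsUnit (A - l • (1 : Matrix (Fin N) (Fin N) ℂ)) →
      φ l = (1 / 2 : ℂ) • (D - Dᴴ) +
        (1 / 2 : ℂ) • (C * (A + l • (1 : Matrix (Fin N) (Fin N) ℂ)) *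
          (A - l • (1 : Matrix (Fin N) (Fin N) ℂ))⁻¹ * H⁻¹ * Cᴴ)) := by
  subst hB
  constructor
  · intro l v hl hv
    have hKH : (H⁻¹)ᴴ = H⁻¹ := by rw [Matrix.conjTranspose_nonsing_inv, hH.eq]
    have hvH : (v • (1 : Matrix (Fin N) (Fin N) ℂ) - A)ᴴ = starRingEnd ℂ v • 1 - Aᴴ := by
      simp [Matrix.conjTranspose_sub, Matrix.conjTranspose_smul]
    have hv' : IsUnit (starRingEnd ℂ v • (1 : Matrix (Fin N) (Fin N) ℂ) - Aᴴ) := by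
      rw [← hvH]
      exact hv.star
    have key := resolvent_sum_of_mul_mul_eq hAH
      (Matrix.nonsing_inv_mul _ ((Matrix.isUnit_iff_isUnit_det _).mp hl))
      (Matrix.mul_nonsing_inv _ ((Matrix.isUnit_iff_isUnit_det _).mp hv'))
    rw [hφ, hφ]
    simp only [Matrix.conjTranspose_add, Matrix.conjTranspose_mul, Matrix.conjTranspose_neg,
      Matrix.conjTranspose_nonsing_inv (v • 1 - A), hvH, hKH, Matrix.conjTranspose_conjTranspose]
    generalize (l • (1 : Matrix (Fin N) (Fin N) ℂ) - A)⁻¹ = R at key ⊢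
    generalize (starRingEnd ℂ v • (1 : Matrix (Fin N) (Fin N) ℂ) - Aᴴ)⁻¹ = S at key ⊢
    have h := congrArg (fun X => -(C * X * Cᴴ)) key
    simp only [Matrix.mul_add, Matrix.add_mul, Matrix.mul_neg, Matrix.neg_mul, Matrix.mul_smul,
      Matrix.smul_mul, neg_neg, ← Matrix.mul_assoc] at h ⊢
    rw [← h, add_add_add_comm, hD]
    abel
  · intro l hl
    have hD' : D = (1 / 2 : ℂ) • (D - Dᴴ) - (1 / 2 : ℂ) • (C * H⁻¹ * Cᴴ) := by
      rw [← neg_eq_iff_eq_neg.mpr hD]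
      module
    rw [hφ, Matrix.mul_assoc C (A + _), add_smul_one_mul_inv_sub_smul_one hl]
    nth_rewrite 1 [hD']
    simp only [Matrix.mul_sub, Matrix.sub_mul, Matrix.mul_neg, Matrix.neg_mul, Matrix.mul_smul,
      Matrix.smul_mul, Matrix.mul_one, ← Matrix.mul_assoc]
    module
end

section
/- Let A, H ∈ ℂ^{N×N} with H Hermitian and invertible and A·H⁻¹·A* = H⁻¹; let D ∈ ℂ^{p×p} and C ∈ ℂ^{p×N} satisfy D + D* = -C·H⁻¹·C*, set B = -A·H⁻¹·C*, and define φ(λ) = D + C·(λ·I_N - A)⁻¹·B. Assume in addition that D = D*, that (1/2)·C·H⁻¹·C* = I_p, and that A is invertible. Then for every λ ∈ ℂ such that A - λ·I_N, φ(λ) + I_p, and I_N - λ·(I_N - (1/2)·H⁻¹·C*·C)·A⁻¹ are all invertible, one has (φ(λ) - I_p)·(φ(λ) + I_p)⁻¹ = (λ/2)·C·A⁻¹·(I_N - λ·(I_N - (1/2)·H⁻¹·C*·C)·A⁻¹)⁻¹·H⁻¹·C*. -/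
open Matrix

/-- The Cayley-type transform `(φ(λ) - I)(φ(λ) + I)⁻¹` of an `H`-unitary realization with
`φ(0) = I_p`. -/
theorem cayley_transform_realization {N p : ℕ}
    (A H : Matrix (Fin N) (Fin N) ℂ) (hH : H.IsHermitian) (hHu : IsUnit H)
    (hAH : A * H⁻¹ * Aᴴ = H⁻¹) (hAu : IsUnit A)
    (D : Matrix (Fin p) (Fin p) ℂ) (C : Matrix (Fin p) (Fin N) ℂ)
    (hD : D + Dᴴ = -(C * H⁻¹ * Cᴴ)) (hDsa : D = Dᴴ)
    (hC : (1 / 2 : ℂ) • (C * H⁻¹ * Cᴴ) = 1)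
    (B : Matrix (Fin N) (Fin p) ℂ) (hB : B = -(A * H⁻¹ * Cᴴ))
    (φ : ℂ → Matrix (Fin p) (Fin p) ℂ)
    (hφ : ∀ l : ℂ, φ l = D + C * (l • (1 : Matrix (Fin N) (Fin N) ℂ) - A)⁻¹ * B) :
    ∀ l : ℂ, IsUnit (A - l • (1 : Matrix (Fin N) (Fin N) ℂ)) →
      IsUnit (φ l + 1) →
      IsUnit ((1 : Matrix (Fin N) (Fin N) ℂ) -
        l • (((1 : Matrix (Fin N) (Fin N) ℂ) - (1 / 2 : ℂ) • (H⁻¹ * Cᴴ * C)) * A⁻¹)) →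
      (φ l - 1) * (φ l + 1)⁻¹ =
        (l / 2) • (C * A⁻¹ *
          ((1 : Matrix (Fin N) (Fin N) ℂ) -
            l • (((1 : Matrix (Fin N) (Fin N) ℂ) - (1 / 2 : ℂ) • (H⁻¹ * Cᴴ * C)) * A⁻¹))⁻¹ *
          H⁻¹ * Cᴴ) := by
  intro l hR hφu hM
  set K := H⁻¹ * Cᴴ with hK
  set M := (1 : Matrix (Fin N) (Fin N) ℂ) - l • ((1 - (1 / 2 : ℂ) • (K * C)) * A⁻¹) with hMdef
  set T := A - l • (1 : Matrix (Fin N) (Fin N) ℂ) with hT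
  have hAi : A⁻¹ * A = 1 := nonsing_inv_mul _ ((isUnit_iff_isUnit_det _).1 hAu)
  have hMi : M⁻¹ * M = 1 := nonsing_inv_mul _ ((isUnit_iff_isUnit_det _).1 hM)
  have hTi : T * T⁻¹ = 1 := mul_nonsing_inv _ ((isUnit_iff_isUnit_det _).1 hR)
  have hTi' : T⁻¹ * T = 1 := nonsing_inv_mul _ ((isUnit_iff_isUnit_det _).1 hR)
  have hCK : C * K = (2 : ℂ) • (1 : Matrix (Fin p) (Fin p) ℂ) := by
    rw [← hC, smul_smul, hK, Matrix.mul_assoc]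
    norm_num
  have hD1 : D = -1 := by
    rw [← hDsa, ← two_smul ℂ D, Matrix.mul_assoc, ← hK, hCK, ← smul_neg] at hD
    exact smul_right_injective _ (two_ne_zero (α := ℂ)) hD
  have hneg : (l • (1 : Matrix (Fin N) (Fin N) ℂ) - A)⁻¹ = -T⁻¹ := by
    rw [← neg_sub A, ← hT]
    exact inv_eq_left_inv (by rw [Matrix.neg_mul, Matrix.mul_neg, neg_neg, hTi'])
  have hTA : T⁻¹ * A = 1 + l • T⁻¹ := by
    have hA : A = T + l • 1 := by rw [hT, sub_add_cancel]
    conv_lhs => rw [hA]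
    rw [Matrix.mul_add, hTi', Matrix.mul_smul, Matrix.mul_one]
  have hφl : φ l = 1 + l • (C * T⁻¹ * K) := by
    rw [hφ, hB, hD1, hneg, Matrix.mul_assoc A, ← hK]
    have : C * -T⁻¹ * -(A * K) = C * (T⁻¹ * A) * K := by
      simp only [Matrix.mul_neg, Matrix.neg_mul, neg_neg, Matrix.mul_assoc]
    rw [this, hTA, Matrix.mul_add, Matrix.add_mul, Matrix.mul_one, hCK, Matrix.mul_smul,
      Matrix.smul_mul, two_smul]
    abel
  have hMA : M * A = T + (l / 2) • (K * C) := by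
    rw [hMdef, hT, Matrix.sub_mul, Matrix.one_mul, Matrix.smul_mul, Matrix.mul_assoc, hAi,
      Matrix.mul_one, smul_sub, smul_smul]
    module
  have hKφ : K * (φ l + 1) = (2 : ℂ) • (M * (A * (T⁻¹ * K))) := by
    rw [← Matrix.mul_assoc M, hMA, hφl, Matrix.add_mul, ← Matrix.mul_assoc T, hTi,
      Matrix.one_mul]
    simp only [Matrix.mul_add, Matrix.mul_one, Matrix.mul_smul, Matrix.smul_mul,
      Matrix.mul_assoc]
    module
  have hmain : (l / 2) • (C * A⁻¹ * M⁻¹ * H⁻¹ * Cᴴ) * (φ l + 1) = φ l - 1 := by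
    rw [Matrix.mul_assoc _ H⁻¹, ← hK, Matrix.smul_mul, Matrix.mul_assoc _ K, hKφ,
      Matrix.mul_smul, Matrix.mul_assoc _ M⁻¹, ← Matrix.mul_assoc M⁻¹, hMi, Matrix.one_mul,
      Matrix.mul_assoc C, ← Matrix.mul_assoc A⁻¹, hAi, Matrix.one_mul, smul_smul,
      div_mul_cancel₀ l two_ne_zero, hφl, add_sub_cancel_left, Matrix.mul_assoc]
  rw [← hmain, Matrix.mul_assoc,
    mul_nonsing_inv _ ((isUnit_iff_isUnit_det _).1 hφu), Matrix.mul_one]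
end

section
/- Let A, H ∈ ℂ^{N×N} with H Hermitian and invertible, A invertible, A·H⁻¹·A* = H⁻¹, and let C ∈ ℂ^{p×N} satisfy (1/2)·C·H⁻¹·C* = I_p. Let M be the (N+p)×(N+p) block matrix M = [[ (I_N - (1/2)·H⁻¹·C*·C)·A⁻¹ , (1/√2)·H⁻¹·C* ], [ (1/√2)·C·A⁻¹ , 0 ]], and let G be the block diagonal matrix G = diag(H⁻¹, I_p). Then M·G·M* = G. -/
open Matrix

/-- The block matrix built from an `H`-unitary realization is `G`-unitary, where
`G = diag(H⁻¹, I_p)`. -/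
theorem block_matrix_G_unitary {N p : ℕ}
    (A H : Matrix (Fin N) (Fin N) ℂ) (hH : H.IsHermitian) (hHu : IsUnit H) (hAu : IsUnit A)
    (hAH : A * H⁻¹ * Aᴴ = H⁻¹)
    (C : Matrix (Fin p) (Fin N) ℂ) (hC : (1 / 2 : ℂ) • (C * H⁻¹ * Cᴴ) = 1) :
    Matrix.fromBlocks
        (((1 : Matrix (Fin N) (Fin N) ℂ) - (1 / 2 : ℂ) • (H⁻¹ * Cᴴ * C)) * A⁻¹)
        (((Real.sqrt 2 : ℂ))⁻¹ • (H⁻¹ * Cᴴ))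
        (((Real.sqrt 2 : ℂ))⁻¹ • (C * A⁻¹)) 0 *
      Matrix.fromBlocks H⁻¹ 0 0 1 *
      (Matrix.fromBlocks
        (((1 : Matrix (Fin N) (Fin N) ℂ) - (1 / 2 : ℂ) • (H⁻¹ * Cᴴ * C)) * A⁻¹)
        (((Real.sqrt 2 : ℂ))⁻¹ • (H⁻¹ * Cᴴ))
        (((Real.sqrt 2 : ℂ))⁻¹ • (C * A⁻¹)) 0)ᴴ =
    Matrix.fromBlocks H⁻¹ 0 0 1 := by
  have hK : (H⁻¹)ᴴ = H⁻¹ := by rw [conjTranspose_nonsing_inv, hH.eq]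
  have hP : C * (H⁻¹ * Cᴴ) = (2 : ℂ) • (1 : Matrix (Fin p) (Fin p) ℂ) := by
    rw [← hC, smul_smul, ← Matrix.mul_assoc]
    norm_num
  have hB : A⁻¹ * (H⁻¹ * (A⁻¹)ᴴ) = H⁻¹ := by
    have hdet : IsUnit A.det := (isUnit_iff_isUnit_det A).mp hAu
    have hstar : Aᴴ * (A⁻¹)ᴴ = 1 := by
      rw [← conjTranspose_mul, nonsing_inv_mul A hdet, conjTranspose_one]
    calc A⁻¹ * (H⁻¹ * (A⁻¹)ᴴ) = A⁻¹ * ((A * H⁻¹ * Aᴴ) * (A⁻¹)ᴴ) := by rw [hAH]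
      _ = (A⁻¹ * A) * H⁻¹ * (Aᴴ * (A⁻¹)ᴴ) := by simp only [Matrix.mul_assoc]
      _ = H⁻¹ := by rw [nonsing_inv_mul A hdet, hstar, Matrix.one_mul, Matrix.mul_one]
  obtain ⟨s, hs⟩ : ∃ s : ℂ, s = ((Real.sqrt 2 : ℂ))⁻¹ := ⟨_, rfl⟩
  have hss : s * s = 1 / 2 := by
    rw [hs, ← mul_inv, ← Complex.ofReal_mul, Real.mul_self_sqrt (by norm_num)]
    norm_num
  have hsc : star s = s := by simp [hs]
  rw [← hs]
  generalize A⁻¹ = B at *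
  generalize H⁻¹ = K at *
  have hBm {q : ℕ} (Y : Matrix (Fin N) (Fin q) ℂ) : B * (K * (Bᴴ * Y)) = K * Y := by
    rw [← Matrix.mul_assoc K, ← Matrix.mul_assoc B, hB]
  have hPm {q : ℕ} (Y : Matrix (Fin p) (Fin q) ℂ) : C * (K * (Cᴴ * Y)) = (2 : ℂ) • Y := by
    rw [← Matrix.mul_assoc K, ← Matrix.mul_assoc C, hP, Matrix.smul_mul, Matrix.one_mul]
  have hhalf : star (1 / 2 : ℂ) = 1 / 2 := by simp
  rw [fromBlocks_conjTranspose, fromBlocks_multiply, fromBlocks_multiply]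
  simp only [conjTranspose_mul, conjTranspose_sub, conjTranspose_smul,
    conjTranspose_conjTranspose, conjTranspose_zero, hK, hsc, hhalf, Matrix.mul_zero,
    Matrix.zero_mul, add_zero, zero_add, Matrix.mul_one, Matrix.mul_assoc, Matrix.mul_smul,
    Matrix.smul_mul, hBm, Matrix.sub_mul, Matrix.mul_sub, Matrix.one_mul, hPm, hP, smul_smul,
    hss, smul_sub]
  simp only [hB, smul_zero, add_zero]
  congr 1
  · module
  · module
  · module
  · match_scalars
    linear_combination 2 * hss
end

section
/- Let A ∈ ℂ^{N×N}, B ∈ ℂ^{N×p}, C ∈ ℂ^{p×N}, D ∈ ℂ^{p×p}, let P ∈ ℂ^{N×N} be Hermitian, and let L ∈ ℂ^{N×r}, W ∈ ℂ^{p×r} satisfy the Kalman–Yakubovich–Popov conditions P - A·P·A* = -L·L*, A·P·C* = -B - L·W*, and W·W* = D + D* + C·P·C*. Define φ(λ) = D + C·(λ·I_N - A)⁻¹·B. Then for all λ, ν ∈ ℂ such that λ·I_N - A and ν·I_N - A are invertible, φ(λ) + (φ(ν))* = (1 - λ·conj(ν)) · C·(λ·I_N - A)⁻¹·P·(conj(ν)·I_N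 - A*)⁻¹·C* + (W - C·(λ·I_N - A)⁻¹·L)·(W* - L*·(conj(ν)·I_N - A*)⁻¹·C*). -/
open Matrix

/-- The Stein operator `P ↦ P - A P A'` conjugated by two resolvents. -/
theorem Matrix.one_sub_mul_smul_resolvent_mul_mul_resolvent {n R : Type*} [Fintype n]
    [DecidableEq n] [CommRing R] (A A' P : Matrix n n R) (a b : R)
    (ha : IsUnit (a • (1 : Matrix n n R) - A)) (hb : IsUnit (b • (1 : Matrix n n R) - A')) :
    (1 - a * b) • ((a • (1 : Matrix n n R) - A)⁻¹ * P * (b • (1 : Matrix n n R) - A')⁻¹) =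
      (a • (1 : Matrix n n R) - A)⁻¹ * (P - A * P * A') * (b • (1 : Matrix n n R) - A')⁻¹ - P -
        (a • (1 : Matrix n n R) - A)⁻¹ * A * P - P * A' * (b • (1 : Matrix n n R) - A')⁻¹ := by
  have hX := Matrix.nonsing_inv_mul _ ((Matrix.isUnit_iff_isUnit_det _).mp ha)
  have hY := Matrix.mul_nonsing_inv _ ((Matrix.isUnit_iff_isUnit_det _).mp hb)
  set X := a • (1 : Matrix n n R) - A with hXdef
  set Y := b • (1 : Matrix n n R) - A' with hYdef
  have key : (1 - a * b) • P = (P - A * P * A') - X * P * Y - A * P * Y - X * P * A' := by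
    simp only [hXdef, hYdef, sub_mul, mul_sub, smul_mul_assoc, mul_smul_comm, one_mul, mul_one,
      sub_smul, one_smul, smul_sub, mul_smul, smul_comm b a]
    abel
  calc (1 - a * b) • (X⁻¹ * P * Y⁻¹) = X⁻¹ * ((1 - a * b) • P) * Y⁻¹ := by
        rw [mul_smul_comm, smul_mul_assoc]
    _ = X⁻¹ * (P - A * P * A') * Y⁻¹ - (X⁻¹ * X) * P * (Y * Y⁻¹) - X⁻¹ * A * P * (Y * Y⁻¹) -
          (X⁻¹ * X) * P * A' * Y⁻¹ := by
        rw [key]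
        simp only [mul_sub, sub_mul, mul_assoc]
    _ = _ := by rw [hX, hY]; simp only [one_mul, mul_one]

/-- The Kalman–Yakubovich–Popov decomposition of the kernel
`(φ(λ) + φ(ν)*) / (1 - λ conj ν)`. -/
theorem kyp_kernel_decomposition {N p r : ℕ}
    (A : Matrix (Fin N) (Fin N) ℂ) (B : Matrix (Fin N) (Fin p) ℂ)
    (C : Matrix (Fin p) (Fin N) ℂ) (D : Matrix (Fin p) (Fin p) ℂ)
    (P : Matrix (Fin N) (Fin N) ℂ) (hP : P.IsHermitian)
    (L : Matrix (Fin N) (Fin r) ℂ) (W : Matrix (Fin p) (Fin r) ℂ)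
    (h1 : P - A * P * Aᴴ = -(L * Lᴴ))
    (h2 : A * P * Cᴴ = -B - L * Wᴴ)
    (h3 : W * Wᴴ = D + Dᴴ + C * P * Cᴴ)
    (φ : ℂ → Matrix (Fin p) (Fin p) ℂ)
    (hφ : ∀ l : ℂ, φ l = D + C * (l • (1 : Matrix (Fin N) (Fin N) ℂ) - A)⁻¹ * B) :
    ∀ l v : ℂ, IsUnit (l • (1 : Matrix (Fin N) (Fin N) ℂ) - A) →
      IsUnit (v • (1 : Matrix (Fin N) (Fin N) ℂ) - A) →
      φ l + (φ v)ᴴ =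
        (1 - l * starRingEnd ℂ v) •
          (C * (l • (1 : Matrix (Fin N) (Fin N) ℂ) - A)⁻¹ * P *
            (starRingEnd ℂ v • (1 : Matrix (Fin N) (Fin N) ℂ) - Aᴴ)⁻¹ * Cᴴ) +
        (W - C * (l • (1 : Matrix (Fin N) (Fin N) ℂ) - A)⁻¹ * L) *
          (Wᴴ - Lᴴ * (starRingEnd ℂ v • (1 : Matrix (Fin N) (Fin N) ℂ) - Aᴴ)⁻¹ * Cᴴ) := by
  intro l v hl hv
  have hv' : (v • (1 : Matrix (Fin N) (Fin N) ℂ) - A)ᴴ = starRingEnd ℂ v • 1 - Aᴴ := by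
    simp [conjTranspose_sub, conjTranspose_smul]
  have hvu : IsUnit (starRingEnd ℂ v • (1 : Matrix (Fin N) (Fin N) ℂ) - Aᴴ) := hv' ▸ hv.star
  have key := one_sub_mul_smul_resolvent_mul_mul_resolvent A Aᴴ P l (starRingEnd ℂ v) hl hvu
  have hB : B = -(A * P * Cᴴ) - L * Wᴴ := by rw [h2]; abel
  have hBH : Bᴴ = -(C * P * Aᴴ) - W * Lᴴ := by
    rw [hB]
    simp [conjTranspose_mul, hP.eq, Matrix.mul_assoc]
  have hD : D + Dᴴ = W * Wᴴ - C * P * Cᴴ := by rw [h3]; abel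
  have hφv : (φ v)ᴴ =
      Dᴴ + Bᴴ * (starRingEnd ℂ v • (1 : Matrix (Fin N) (Fin N) ℂ) - Aᴴ)⁻¹ * Cᴴ := by
    rw [hφ, conjTranspose_add, conjTranspose_mul, conjTranspose_mul, conjTranspose_nonsing_inv,
      hv', Matrix.mul_assoc]
  rw [hφv, hφ, hBH, add_add_add_comm, hD, hB]
  generalize (l • (1 : Matrix (Fin N) (Fin N) ℂ) - A)⁻¹ = R at *
  generalize (starRingEnd ℂ v • (1 : Matrix (Fin N) (Fin N) ℂ) - Aᴴ)⁻¹ = S at *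
  have hCC : (1 - l * starRingEnd ℂ v) • (C * R * P * S * Cᴴ) =
      C * ((1 - l * starRingEnd ℂ v) • (R * P * S)) * Cᴴ := by
    simp only [Matrix.mul_smul, Matrix.smul_mul, Matrix.mul_assoc]
  rw [hCC, key, h1]
  simp only [Matrix.mul_sub, Matrix.sub_mul, Matrix.mul_neg, Matrix.neg_mul, Matrix.mul_assoc]
  abel
end

section
/- Let a ∈ ℂ^{ℓ×ℓ} have spectral radius strictly less than 1 (i.e. every eigenvalue of a has modulus < 1), let b ∈ ℂ^{ℓ×p}, c ∈ ℂ^{p×ℓ}, d ∈ ℂ^{p×p}, and let X = ∑_{t=0}^{∞} a^t·b·b*·(a*)^t (this series converges). Define R₀ = d·d* + c·X·c*, R_k = (d·b* + c·X·a*)·(a*)^{k-1}·c* for k ≥ 1, and R_{-k} = (R_k)* for k ≥ 1. Then for every λ ∈ ℂ with |λ| = 1, the matrices λ·I_ℓ - a and I_ℓ - λ·a* are invertible and the series ∑_{k∈ℤ} λ^k·R_k converges to (d + c·(λ·I_ℓ - a)⁻¹·b) · (d* + λ·b*·(I_ℓ - λ·a*)⁻¹·c*). -/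
open Matrix

/-- In a complex Banach algebra, the powers of an element whose spectrum lies in the open unit
disc are absolutely summable. -/
theorem summable_norm_pow_of_spectrum_norm_lt_one {A : Type*} [NormedRing A] [NormedAlgebra ℂ A]
    [CompleteSpace A] (a : A) (ha : ∀ z ∈ spectrum ℂ a, ‖z‖ < 1) :
    Summable (fun n : ℕ => ‖a ^ n‖) := by
  have hr : spectralRadius ℂ a < 1 := by
    rcases (spectrum ℂ a).eq_empty_or_nonempty with h | h
    · simp [spectralRadius, h]
    · exact_mod_cast spectrum.spectralRadius_lt_of_forall_lt_of_nonempty h (r := 1)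
        (fun z hz => by exact_mod_cast ha z hz)
  obtain ⟨r, hr1, hr2⟩ := ENNReal.lt_iff_exists_nnreal_btwn.1 hr
  have hr2' : r < 1 := by exact_mod_cast hr2
  have hev := (spectrum.pow_nnnorm_pow_one_div_tendsto_nhds_spectralRadius a).eventually_lt_const hr1
  refine Summable.of_norm_bounded_eventually_nat (g := fun n : ℕ => (r : ℝ) ^ n)
    (summable_geometric_of_lt_one r.2 (by exact_mod_cast hr2')) ?_
  filter_upwards [hev, Filter.eventually_gt_atTop 0] with n hn hn0
  have hn0' : (0 : ℝ) < n := by exact_mod_cast hn0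
  have h1 : ((‖a ^ n‖₊ : ENNReal)) ≤ (r : ENNReal) ^ (n : ℝ) := by
    rw [one_div] at hn
    exact (ENNReal.rpow_inv_le_iff hn0').1 hn.le
  rw [ENNReal.rpow_natCast] at h1
  have h2 : ‖a ^ n‖₊ ≤ r ^ n := by exact_mod_cast h1
  rw [norm_norm]
  exact_mod_cast h2

section

open scoped Matrix.Norms.L2Operator

/-- The powers of a complex matrix with spectrum in the open unit disc, multiplied by unimodular
scalars, form a summable geometric series. -/
theorem Matrix.summable_smul_pow_of_summable_norm_pow {n : Type*} [Fintype n] [DecidableEq n]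
    {a : Matrix n n ℂ} (ha : Summable (fun k : ℕ => ‖a ^ k‖)) {z : ℂ} (hz : ‖z‖ = 1) :
    Summable (fun k : ℕ => (z • a) ^ k) := by
  refine Summable.of_norm_bounded ha fun k => ?_
  simp [smul_pow, norm_smul, hz]

theorem Matrix.summable_norm_conjTranspose_pow {n : Type*} [Fintype n] [DecidableEq n]
    {a : Matrix n n ℂ} (ha : Summable (fun k : ℕ => ‖a ^ k‖)) :
    Summable (fun k : ℕ => ‖aᴴ ^ k‖) := by
  refine ha.congr fun k => ?_
  rw [← conjTranspose_pow, Matrix.l2_opNorm_conjTranspose]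

/-- Convergence of the series `∑ aᵗ m (a*)ᵗ`. -/
theorem Matrix.summable_pow_mul_conjTranspose_pow {n : Type*} [Fintype n] [DecidableEq n]
    {a : Matrix n n ℂ} (ha : Summable (fun k : ℕ => ‖a ^ k‖)) (m : Matrix n n ℂ) :
    Summable (fun k : ℕ => a ^ k * m * aᴴ ^ k) := by
  have hb := ha.mul_of_nonneg (summable_norm_conjTranspose_pow ha)
    (fun _ => norm_nonneg _) (fun _ => norm_nonneg _)
  have hd : Summable (fun k : ℕ => ‖a ^ k‖ * ‖aᴴ ^ k‖) :=
    hb.comp_injective (i := fun k : ℕ => (k, k)) fun x y h => congrArg Prod.fst h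
  refine Summable.of_norm_bounded (hd.mul_left ‖m‖) fun k => ?_
  calc ‖a ^ k * m * aᴴ ^ k‖ ≤ ‖a ^ k‖ * ‖m‖ * ‖aᴴ ^ k‖ :=
        (norm_mul_le _ _).trans (by gcongr; exact norm_mul_le _ _)
    _ = ‖m‖ * (‖a ^ k‖ * ‖aᴴ ^ k‖) := by ring

theorem Matrix.summable_norm_pow {n : Type*} [Fintype n] [DecidableEq n]
    (a : Matrix n n ℂ) (ha : ∀ z ∈ spectrum ℂ a, ‖z‖ < 1) :
    Summable (fun k : ℕ => ‖a ^ k‖) :=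
  summable_norm_pow_of_spectrum_norm_lt_one a ha

end

/-- Neumann series for matrices. -/
theorem Matrix.hasSum_pow_inv_one_sub {n : Type*} [Fintype n] [DecidableEq n] {a : Matrix n n ℂ}
    (ha : Summable (fun k : ℕ => a ^ k)) :
    IsUnit (1 - a) ∧ HasSum (fun k : ℕ => a ^ k) (1 - a)⁻¹ := by
  have h := ha.one_sub_mul_tsum_pow
  exact ⟨IsUnit.of_mul_eq_one _ h, Matrix.inv_eq_right_inv h ▸ ha.hasSum⟩

theorem HasSum.matrix_mul_mul {ι m n o q : Type*} [Fintype n] [Fintype o]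
    {f : ι → Matrix n o ℂ} {s : Matrix n o ℂ} (hf : HasSum f s)
    (u : Matrix m n ℂ) (v : Matrix o q ℂ) :
    HasSum (fun i => u * f i * v) (u * s * v) :=
  hf.map (AddMonoidHom.mk' (fun x : Matrix n o ℂ => u * x * v)
    fun x y => by rw [Matrix.mul_add, Matrix.add_mul])
    ((continuous_const.matrix_mul continuous_id).matrix_mul continuous_const)

/-- The series `x = ∑ aᵗ m (a*)ᵗ` solves the Stein equation `x - a x a* = m`. -/
theorem Matrix.tsum_pow_mul_conjTranspose_pow_eq {n : Type*} [Fintype n] [DecidableEq n]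
    {a m : Matrix n n ℂ} (h : Summable (fun k : ℕ => a ^ k * m * aᴴ ^ k)) :
    ∑' k : ℕ, a ^ k * m * aᴴ ^ k = m + a * (∑' k : ℕ, a ^ k * m * aᴴ ^ k) * aᴴ := by
  conv_lhs => rw [h.tsum_eq_zero_add]
  rw [← (h.hasSum.matrix_mul_mul a aᴴ).tsum_eq]
  simp [pow_succ' a, pow_succ aᴴ, Matrix.mul_assoc]

theorem Matrix.isHermitian_tsum_pow_mul_conjTranspose_pow {n : Type*} [Fintype n] [DecidableEq n]
    {a m : Matrix n n ℂ} (hm : m.IsHermitian) :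
    (∑' k : ℕ, a ^ k * m * aᴴ ^ k).IsHermitian := by
  rw [Matrix.IsHermitian, Matrix.conjTranspose_tsum]
  simp [Matrix.conjTranspose_mul, Matrix.conjTranspose_pow, hm.eq, Matrix.mul_assoc]

/-- A solution of the Stein equation expresses the product of the two resolvents. -/
theorem Matrix.stein_resolvent_identity {n : Type*} [Fintype n] [DecidableEq n]
    {a e x m : Matrix n n ℂ} {z : ℂ} (hx : x = m + a * x * e)
    (h₁ : IsUnit (z • (1 : Matrix n n ℂ) - a)) (h₂ : IsUnit (1 - z • e)) :
    x + z • (x * e * (1 - z • e)⁻¹) + (z • (1 : Matrix n n ℂ) - a)⁻¹ * a * x =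
      z • ((z • (1 : Matrix n n ℂ) - a)⁻¹ * m * (1 - z • e)⁻¹) := by
  have hA := Matrix.mul_nonsing_inv _ ((Matrix.isUnit_iff_isUnit_det _).1 h₁)
  have hB := Matrix.nonsing_inv_mul _ ((Matrix.isUnit_iff_isUnit_det _).1 h₂)
  apply h₁.mul_left_cancel
  apply h₂.mul_right_cancel
  set A := (z • (1 : Matrix n n ℂ) - a)⁻¹
  set B := (1 - z • e)⁻¹
  have hm : m = x - a * x * e := eq_sub_of_add_eq hx.symm
  set P := z • (1 : Matrix n n ℂ) - a with hP
  set Q := 1 - z • e with hQ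
  have e1 : P * (x + z • (x * e * B) + A * a * x) * Q =
      P * x * Q + z • (P * x * e * (B * Q)) + (P * A) * a * x * Q := by
    simp only [Matrix.mul_add, Matrix.add_mul, Matrix.mul_smul, Matrix.smul_mul, Matrix.mul_assoc]
  have e2 : P * (z • (A * m * B)) * Q = z • ((P * A) * m * (B * Q)) := by
    simp only [Matrix.mul_smul, Matrix.smul_mul, Matrix.mul_assoc]
  rw [e1, e2, hA, hB, hm, hP, hQ]
  simp only [Matrix.mul_sub, Matrix.sub_mul, Matrix.mul_smul, Matrix.smul_mul, Matrix.mul_assoc,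
    Matrix.one_mul, Matrix.mul_one, smul_sub]
  abel

/-- Fourier expansion of the rational spectral function: with `a` of spectral radius `< 1`
and `X = ∑_{t≥0} aᵗ b b* (a*)ᵗ` (a convergent series), the Laurent series
`∑_{k∈ℤ} λᵏ R_k` converges on the unit circle to
`(d + c (λI - a)⁻¹ b)(d* + λ b* (I - λ a*)⁻¹ c*)`. -/
theorem fourier_coefficients_spectral_function {l p : ℕ}
    (a : Matrix (Fin l) (Fin l) ℂ) (ha : ∀ z ∈ spectrum ℂ a, ‖z‖ < 1)
    (b : Matrix (Fin l) (Fin p) ℂ) (c : Matrix (Fin p) (Fin l) ℂ)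
    (d : Matrix (Fin p) (Fin p) ℂ)
    (R : ℤ → Matrix (Fin p) (Fin p) ℂ)
    (hR0 : R 0 = d * dᴴ + c * (∑' t : ℕ, a ^ t * (b * bᴴ) * aᴴ ^ t) * cᴴ)
    (hRpos : ∀ k : ℕ, R ((k : ℤ) + 1) =
      (d * bᴴ + c * (∑' t : ℕ, a ^ t * (b * bᴴ) * aᴴ ^ t) * aᴴ) * aᴴ ^ k * cᴴ)
    (hRneg : ∀ k : ℕ, R (-((k : ℤ) + 1)) = (R ((k : ℤ) + 1))ᴴ) :
    Summable (fun t : ℕ => a ^ t * (b * bᴴ) * aᴴ ^ t) ∧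
    ∀ z : ℂ, ‖z‖ = 1 →
      IsUnit (z • (1 : Matrix (Fin l) (Fin l) ℂ) - a) ∧
      IsUnit ((1 : Matrix (Fin l) (Fin l) ℂ) - z • aᴴ) ∧
      HasSum (fun k : ℤ => z ^ k • R k)
        ((d + c * (z • (1 : Matrix (Fin l) (Fin l) ℂ) - a)⁻¹ * b) *
          (dᴴ + z • (bᴴ * ((1 : Matrix (Fin l) (Fin l) ℂ) - z • aᴴ)⁻¹ * cᴴ))) := by
  have hs := Matrix.summable_norm_pow a ha
  have hX := Matrix.summable_pow_mul_conjTranspose_pow hs (b * bᴴ)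
  refine ⟨hX, fun z hz => ?_⟩
  have hXeq := Matrix.tsum_pow_mul_conjTranspose_pow_eq hX
  have hXh := Matrix.isHermitian_tsum_pow_mul_conjTranspose_pow (a := a)
    (Matrix.isHermitian_mul_conjTranspose_self b)
  set X := ∑' t : ℕ, a ^ t * (b * bᴴ) * aᴴ ^ t
  have hz0 : z ≠ 0 := by rintro rfl; simp at hz
  obtain ⟨hU₂, hB⟩ := Matrix.hasSum_pow_inv_one_sub
    (Matrix.summable_smul_pow_of_summable_norm_pow (Matrix.summable_norm_conjTranspose_pow hs) hz)
  obtain ⟨hU, hA⟩ := Matrix.hasSum_pow_inv_one_sub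
    (Matrix.summable_smul_pow_of_summable_norm_pow hs (z := z⁻¹) (by simp [hz]))
  have hfac : z • (1 : Matrix (Fin l) (Fin l) ℂ) - a = z • (1 - z⁻¹ • a) := by
    rw [smul_sub, smul_inv_smul₀ hz0]
  have hU₁ : IsUnit (z • (1 : Matrix (Fin l) (Fin l) ℂ) - a) := by
    rw [hfac]
    exact hU.smul (Units.mk0 z hz0)
  have hinv : (z • (1 : Matrix (Fin l) (Fin l) ℂ) - a)⁻¹ = z⁻¹ • (1 - z⁻¹ • a)⁻¹ := by
    rw [hfac]
    exact Matrix.inv_smul' _ (Units.mk0 z hz0) ((Matrix.isUnit_iff_isUnit_det _).1 hU)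
  refine ⟨hU₁, hU₂, ?_⟩
  have key := Matrix.stein_resolvent_identity hXeq hU₁ hU₂
  have hpos := (hB.matrix_mul_mul (d * bᴴ + c * X * aᴴ) cᴴ).const_smul z
  have hneg := (hA.matrix_mul_mul c (b * dᴴ + a * X * cᴴ)).const_smul z⁻¹
  have hnat : HasSum (fun k : ℕ => z ^ (k : ℤ) • R k)
      (R 0 + z • ((d * bᴴ + c * X * aᴴ) * (1 - z • aᴴ)⁻¹ * cᴴ)) := by
    refine (hasSum_nat_add_iff' 1).1 ?_
    rw [Finset.sum_range_one, Nat.cast_zero, zpow_zero, one_smul, add_sub_cancel_left]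
    refine (congrArg (HasSum · _) (funext fun k => ?_)).mpr hpos
    rw [Nat.cast_add_one, hRpos, zpow_add_one₀ hz0, zpow_natCast, smul_pow, Matrix.mul_smul,
      Matrix.smul_mul, smul_smul, mul_comm]
  have hnegs : HasSum (fun k : ℕ => z ^ (-((k : ℤ) + 1)) • R (-((k : ℤ) + 1)))
      (z⁻¹ • (c * (1 - z⁻¹ • a)⁻¹ * (b * dᴴ + a * X * cᴴ))) := by
    refine (congrArg (HasSum · _) (funext fun k => ?_)).mpr hneg
    rw [hRneg, hRpos, _root_.zpow_neg, zpow_add_one₀ hz0, zpow_natCast, smul_pow, Matrix.mul_smul,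
      Matrix.smul_mul, smul_smul, mul_inv, inv_pow, mul_comm]
    simp [Matrix.conjTranspose_mul, Matrix.conjTranspose_pow, hXh.eq, Matrix.mul_assoc]
  refine (congrArg (HasSum _ ·) ?_).mpr (hnat.of_nat_of_neg_add_one hnegs)
  have hneg' : z⁻¹ • (c * (1 - z⁻¹ • a)⁻¹ * (b * dᴴ + a * X * cᴴ)) =
      c * (z • (1 : Matrix (Fin l) (Fin l) ℂ) - a)⁻¹ * (b * dᴴ + a * X * cᴴ) := by
    rw [hinv, Matrix.mul_smul, Matrix.smul_mul]
  rw [hneg', hR0]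
  set A := (z • (1 : Matrix (Fin l) (Fin l) ℂ) - a)⁻¹
  set B := (1 - z • aᴴ)⁻¹
  have key' := congrArg (fun m => c * m * cᴴ) key
  simp only [Matrix.mul_add, Matrix.add_mul, Matrix.mul_smul, Matrix.smul_mul, Matrix.mul_assoc,
    smul_add] at key' ⊢
  rw [← key']
  abel
end

section
/- Let a ∈ ℂ^{ℓ×ℓ} be invertible and let b ∈ ℂ^{ℓ×p}, c ∈ ℂ^{p×ℓ}, d ∈ ℂ^{p×p}, X ∈ ℂ^{ℓ×ℓ} be arbitrary. Define R₀ = d·d* + c·X·c* and R_k = (d·b* + c·X·a*)·(a*)^{k-1}·c* for k ≥ 1. Then for every m ∈ ℕ, ∑_{k=0}^{m} 2^{k/2}·(-i)^{m-k}·binom(m,k)·R_k = (-i)^m·d·(d* - b*·a^{-*}·c*) + (d·b*·a^{-*} + c·X)·(√2·a* - i·I_ℓ)^m·c*, where a^{-*} = (a*)⁻¹. -/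
open Matrix Finset

/-- Binomial expansion of `(s • A - t • 1) ^ m` in powers of `A`. -/
theorem smul_sub_smul_one_pow {K S : Type*} [CommRing K] [Ring S] [Algebra K S]
    (s t : K) (A : S) (m : ℕ) :
    (s • A - t • (1 : S)) ^ m =
      ∑ k ∈ Finset.range (m + 1), (s ^ k * (-t) ^ (m - k) * (m.choose k : K)) • A ^ k := by
  have hc : Commute (s • A) ((-t) • (1 : S)) := ((Commute.one_right A).smul_left s).smul_right (-t)
  rw [sub_eq_add_neg, ← neg_smul, hc.add_pow]
  refine Finset.sum_congr rfl fun k _ => ?_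
  rw [smul_pow, smul_pow, one_pow, ← nsmul_eq_mul', smul_mul_smul_comm, mul_one,
    ← Nat.cast_smul_eq_nsmul K, smul_smul, mul_comm (m.choose k : K)]

/-- The binomial combination of the Fourier coefficients `R_k` giving the boundary values
of the associated discrete analytic function. -/
theorem boundary_values_from_fourier_coefficients {l p : ℕ}
    (a : Matrix (Fin l) (Fin l) ℂ) (ha : IsUnit a)
    (b : Matrix (Fin l) (Fin p) ℂ) (c : Matrix (Fin p) (Fin l) ℂ)
    (d : Matrix (Fin p) (Fin p) ℂ) (X : Matrix (Fin l) (Fin l) ℂ)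
    (R : ℕ → Matrix (Fin p) (Fin p) ℂ)
    (hR0 : R 0 = d * dᴴ + c * X * cᴴ)
    (hRk : ∀ k : ℕ, R (k + 1) = (d * bᴴ + c * X * aᴴ) * aᴴ ^ k * cᴴ) (m : ℕ) :
    ∑ k ∈ Finset.range (m + 1),
        ((Real.sqrt 2 : ℂ) ^ k * (-Complex.I) ^ (m - k) * (m.choose k : ℂ)) • R k =
      ((-Complex.I) ^ m) • (d * (dᴴ - bᴴ * (aᴴ)⁻¹ * cᴴ)) +
        (d * bᴴ * (aᴴ)⁻¹ + c * X) *
          ((Real.sqrt 2 : ℂ) • aᴴ - Complex.I • (1 : Matrix (Fin l) (Fin l) ℂ)) ^ m * cᴴ := by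
  have hdet : IsUnit aᴴ.det := (Matrix.isUnit_iff_isUnit_det _).mp ha.star
  have hR : ∀ k, R k = (if k = 0 then d * (dᴴ - bᴴ * (aᴴ)⁻¹ * cᴴ) else 0) +
      (d * bᴴ * (aᴴ)⁻¹ + c * X) * aᴴ ^ k * cᴴ := by
    rintro (_ | k)
    · simp only [hR0, if_true, pow_zero, Matrix.mul_one, Matrix.mul_sub, Matrix.add_mul,
        Matrix.mul_assoc]
      abel
    · have hP : (d * bᴴ * (aᴴ)⁻¹ + c * X) * aᴴ = d * bᴴ + c * X * aᴴ := by
        rw [Matrix.add_mul, Matrix.nonsing_inv_mul_cancel_right _ _ hdet]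
      rw [hRk, if_neg k.succ_ne_zero, zero_add, pow_succ', ← Matrix.mul_assoc _ aᴴ, hP]
  simp only [hR, smul_add, Finset.sum_add_distrib, smul_ite, smul_zero]
  rw [smul_sub_smul_one_pow, Matrix.mul_sum, Matrix.sum_mul]
  simp
end

section
/- Let A₁, A₂ ∈ ℂ^{N×N}, C ∈ ℂ^{p×N}, B ∈ ℂ^{N×q}, with the pair (C, A₁) observable and the pair (A₂, B) controllable, and define f(m,n) = C·A₁^m·A₂^n·B for m,n ∈ ℕ. Then f is discrete analytic (i.e. f(m,n) + i·f(m+1,n) - i·f(m,n+1) - f(m+1,n+1) = 0 for all m,n ∈ ℕ) if and only if I_N + i·A₁ - i·A₂ - A₁·A₂ = 0. Moreover, if this relation holds, then i·I_N + A₁ is invertible, A₂ = (i·I_N + A₁)⁻¹·(I_N + i·A₁), and A₁·A₂ = A₂·A₁. -/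
open Matrix

/-- If `C A₁ᵐ E A₂ⁿ B = 0` for all `m, n`, with `(C, A₁)` observable and `(A₂, B)` controllable,
then `E = 0`. -/
theorem eq_zero_of_observable_of_controllable {N p q : ℕ}
    (A₁ A₂ E : Matrix (Fin N) (Fin N) ℂ)
    (C : Matrix (Fin p) (Fin N) ℂ) (B : Matrix (Fin N) (Fin q) ℂ)
    (hobs : ∀ x : Fin N → ℂ, (∀ n : ℕ, C.mulVec ((A₁ ^ n).mulVec x) = 0) → x = 0)
    (hctrl : Submodule.span ℂ
      {v : Fin N → ℂ | ∃ (n : ℕ) (j : Fin q), v = fun i => (A₂ ^ n * B) i j} = ⊤)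
    (h : ∀ m n : ℕ, C * A₁ ^ m * E * (A₂ ^ n * B) = 0) : E = 0 := by
  have hlin : Matrix.mulVecLin E = 0 := by
    refine LinearMap.ext_on hctrl ?_
    rintro v ⟨n, j, rfl⟩
    refine hobs _ fun m => ?_
    rw [Matrix.mulVecLin_apply, Matrix.mulVec_mulVec, Matrix.mulVec_mulVec]
    ext i
    exact congrFun (congrFun (h m n) i) j
  ext i j
  simpa using congrFun (LinearMap.congr_fun hlin (Pi.single j 1)) i

/-- If `1 + i A₁ - i A₂ - A₁ A₂ = 0`, then the product of `i + A₁` and `A₂ - i` is `2`. -/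
theorem add_mul_sub_eq_two {N : ℕ} {A₁ A₂ : Matrix (Fin N) (Fin N) ℂ}
    (h : (1 : Matrix (Fin N) (Fin N) ℂ) + Complex.I • A₁ - Complex.I • A₂ - A₁ * A₂ = 0) :
    (Complex.I • (1 : Matrix (Fin N) (Fin N) ℂ) + A₁) * (A₂ - Complex.I • 1) =
      (2 : ℂ) • (1 : Matrix (Fin N) (Fin N) ℂ) := by
  simp only [add_mul, mul_sub, smul_mul_assoc, mul_smul_comm, one_mul, mul_one,
    ← sub_eq_zero.mp h]
  match_scalars
  all_goals ring_nf
  rw [Complex.I_sq]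
  norm_num

/-- `f(m,n) = C A₁ᵐ A₂ⁿ B` (with `(C,A₁)` observable and `(A₂,B)` controllable) is
discrete analytic iff `I + iA₁ - iA₂ - A₁A₂ = 0`; in that case `iI + A₁` is invertible,
`A₂ = (iI + A₁)⁻¹ (I + iA₁)`, and `A₁` and `A₂` commute. -/
theorem discrete_analytic_realization_iff {N p q : ℕ}
    (A₁ A₂ : Matrix (Fin N) (Fin N) ℂ)
    (C : Matrix (Fin p) (Fin N) ℂ) (B : Matrix (Fin N) (Fin q) ℂ)
    (hobs : ∀ x : Fin N → ℂ, (∀ n : ℕ, C.mulVec ((A₁ ^ n).mulVec x) = 0) → x = 0)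
    (hctrl : Submodule.span ℂ
      {v : Fin N → ℂ | ∃ (n : ℕ) (j : Fin q), v = fun i => (A₂ ^ n * B) i j} = ⊤) :
    ((∀ m n : ℕ,
        C * A₁ ^ m * A₂ ^ n * B + Complex.I • (C * A₁ ^ (m + 1) * A₂ ^ n * B)
          - Complex.I • (C * A₁ ^ m * A₂ ^ (n + 1) * B)
          - C * A₁ ^ (m + 1) * A₂ ^ (n + 1) * B = 0) ↔
      (1 : Matrix (Fin N) (Fin N) ℂ) + Complex.I • A₁ - Complex.I • A₂ - A₁ * A₂ = 0) ∧
    ((1 : Matrix (Fin N) (Fin N) ℂ) + Complex.I • A₁ - Complex.I • A₂ - A₁ * A₂ = 0 →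
      IsUnit (Complex.I • (1 : Matrix (Fin N) (Fin N) ℂ) + A₁) ∧
      A₂ = (Complex.I • (1 : Matrix (Fin N) (Fin N) ℂ) + A₁)⁻¹ *
        ((1 : Matrix (Fin N) (Fin N) ℂ) + Complex.I • A₁) ∧
      A₁ * A₂ = A₂ * A₁) := by
  have hfactor : ∀ m n : ℕ,
      C * A₁ ^ m * A₂ ^ n * B + Complex.I • (C * A₁ ^ (m + 1) * A₂ ^ n * B)
          - Complex.I • (C * A₁ ^ m * A₂ ^ (n + 1) * B)
          - C * A₁ ^ (m + 1) * A₂ ^ (n + 1) * B =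
        C * A₁ ^ m * (1 + Complex.I • A₁ - Complex.I • A₂ - A₁ * A₂) * (A₂ ^ n * B) := by
    intro m n
    simp only [pow_succ A₁, pow_succ' A₂, Matrix.mul_add, Matrix.mul_sub, Matrix.add_mul,
      Matrix.sub_mul, Matrix.mul_smul, Matrix.smul_mul, Matrix.mul_one, Matrix.mul_assoc]
  refine ⟨⟨fun h => ?_, fun h m n => ?_⟩, fun h => ?_⟩
  · exact eq_zero_of_observable_of_controllable A₁ A₂ _ C B hobs hctrl
      fun m n => (hfactor m n).symm.trans (h m n)
  · rw [hfactor, h, Matrix.mul_zero, Matrix.zero_mul]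
  · have h2 := add_mul_sub_eq_two h
    have hinv : (Complex.I • (1 : Matrix (Fin N) (Fin N) ℂ) + A₁) *
        ((2⁻¹ : ℂ) • (A₂ - Complex.I • 1)) = 1 := by
      rw [mul_smul_comm, h2, smul_smul]
      norm_num
    have hunit : IsUnit (Complex.I • (1 : Matrix (Fin N) (Fin N) ℂ) + A₁) :=
      IsUnit.of_mul_eq_one _ hinv
    refine ⟨hunit, ?_, ?_⟩
    · have hA : (1 : Matrix (Fin N) (Fin N) ℂ) + Complex.I • A₁ =
          (Complex.I • (1 : Matrix (Fin N) (Fin N) ℂ) + A₁) * A₂ := by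
        rw [add_mul, smul_mul_assoc, one_mul]
        rw [← sub_eq_zero.mp h]
        module
      rw [hA, Matrix.nonsing_inv_mul_cancel_left _ _ ((Matrix.isUnit_iff_isUnit_det _).mp hunit)]
    · have hcomm : Commute (Complex.I • (1 : Matrix (Fin N) (Fin N) ℂ) + A₁)
          ((2⁻¹ : ℂ) • (A₂ - Complex.I • 1)) := hinv.trans (mul_eq_one_comm.mp hinv).symm
      have hscalar : ∀ X : Matrix (Fin N) (Fin N) ℂ, Commute (Complex.I • 1) X := fun X =>
        (Commute.one_left X).smul_left _
      have hsub : Commute (Complex.I • (1 : Matrix (Fin N) (Fin N) ℂ) + A₁)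
          (A₂ - Complex.I • 1) := (Commute.smul_right_iff₀ (by norm_num)).mp hcomm
      have hA : Commute (Complex.I • (1 : Matrix (Fin N) (Fin N) ℂ) + A₁) A₂ := by
        simpa using hsub.add_right (hscalar _).symm
      simpa using (hA.sub_left (hscalar A₂)).eq
end

section
/- Let A ∈ ℂ^{N×N} and set α₊ = (1+i)/2 and α₋ = (1-i)/2. Assume that I_N + α₋·A is invertible. Then the matrix-valued function f(m,n) = (I_N + A)^m · (I_N + α₊·A)^n · (I_N + α₋·A)^{-n} defined for m,n ∈ ℕ is discrete analytic, i.e. f(m,n) + i·f(m+1,n) - i·f(m,n+1) - f(m+1,n+1) = 0 for all m,n ∈ ℕ. -/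
open Matrix

/-- The quadratic identity satisfied by the three factors of the matrix power function. -/
theorem power_function_factors_identity {R : Type*} [Ring R] [Algebra ℂ R] (A : R) :
    (1 + ((1 - Complex.I) / 2) • A)
      + Complex.I • ((1 + A) * (1 + ((1 - Complex.I) / 2) • A))
      - Complex.I • (1 + ((1 + Complex.I) / 2) • A)
      - (1 + A) * (1 + ((1 + Complex.I) / 2) • A) = 0 := by
  simp only [mul_add, add_mul, mul_one, one_mul, mul_smul_comm]
  match_scalars
  · ring
  · linear_combination -Complex.I_mul_I
  · linear_combination (-1 / 2 : ℂ) * Complex.I_mul_I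

/-- The matrix-valued function `f(m,n) = (I+A)^m (I+α₊A)^n (I+α₋A)^{-n}` with
`α₊ = (1+i)/2`, `α₋ = (1-i)/2` is discrete analytic. -/
theorem matrix_power_function_discrete_analytic {N : ℕ}
    (A : Matrix (Fin N) (Fin N) ℂ)
    (hinv : IsUnit ((1 : Matrix (Fin N) (Fin N) ℂ) + (((1 : ℂ) - Complex.I) / 2) • A))
    (f : ℕ → ℕ → Matrix (Fin N) (Fin N) ℂ)
    (hf : ∀ m n : ℕ, f m n =
      ((1 : Matrix (Fin N) (Fin N) ℂ) + A) ^ m *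
        ((1 : Matrix (Fin N) (Fin N) ℂ) + (((1 : ℂ) + Complex.I) / 2) • A) ^ n *
        (((1 : Matrix (Fin N) (Fin N) ℂ) + (((1 : ℂ) - Complex.I) / 2) • A)⁻¹) ^ n) :
    ∀ m n : ℕ,
      f m n + Complex.I • f (m + 1) n - Complex.I • f m (n + 1) - f (m + 1) (n + 1) = 0 := by
  intro m n
  have key := power_function_factors_identity A
  set P := 1 + A with hP
  set Q := 1 + (((1 : ℂ) + Complex.I) / 2) • A with hQ
  set R := 1 + (((1 : ℂ) - Complex.I) / 2) • A with hR
  have hPQ : Commute P Q :=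
    (Commute.one_left _).add_left
      ((Commute.one_right A).add_right ((Commute.refl A).smul_right _))
  have hRS : R * R⁻¹ = 1 := Matrix.mul_nonsing_inv R ((Matrix.isUnit_iff_isUnit_det R).mp hinv)
  have hS : R⁻¹ ^ n = R * R⁻¹ ^ (n + 1) := by
    rw [pow_succ', ← mul_assoc, hRS, one_mul]
  have hPn : P ^ (m + 1) * Q ^ n = P ^ m * Q ^ n * P := by
    rw [pow_succ, mul_assoc, (hPQ.pow_right n).eq, mul_assoc]
  have hPn' : P ^ (m + 1) * Q ^ (n + 1) = P ^ m * Q ^ n * (P * Q) := by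
    rw [pow_succ Q, ← mul_assoc, hPn, mul_assoc]
  have hQn : P ^ m * Q ^ (n + 1) = P ^ m * Q ^ n * Q := by
    rw [pow_succ Q, ← mul_assoc]
  have factored : f m n + Complex.I • f (m + 1) n - Complex.I • f m (n + 1) - f (m + 1) (n + 1)
      = P ^ m * Q ^ n * (R + Complex.I • (P * R) - Complex.I • Q - P * Q) * R⁻¹ ^ (n + 1) := by
    rw [hf, hf, hf, hf, hPn', hPn, hQn, hS]
    simp only [mul_add, mul_sub, add_mul, sub_mul, mul_smul_comm, smul_mul_assoc, mul_assoc]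
  rw [factored, key, mul_zero, zero_mul]
end

section
/- Let U ∈ ℂ^{N×N} be unitary (U·U* = U*·U = I_N) and let C ∈ ℂ^{p×N}. Let λ, ν ∈ ℂ be such that the matrices S = I_N - λ·(√2·U* - i·I_N) and T = I_N - conj(ν)·(√2·U + i·I_N) are invertible. Then (1 + i·λ)·C·S⁻¹·C* + (1 - i·conj(ν))·C·T⁻¹·C* - C·C* = (1 + i·λ - i·conj(ν) - λ·conj(ν)) · C·S⁻¹·T⁻¹·C*. -/
open Matrix

/-- If `a • T + b • S - S * T` is the scalar `k`, then `S⁻¹` and `T⁻¹` satisfy the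
corresponding resolvent identity. -/
theorem smul_inv_add_smul_inv_sub_one {n R : Type*} [Fintype n] [DecidableEq n] [CommRing R]
    {S T : Matrix n n R} (hS : IsUnit S) (hT : IsUnit T) {a b k : R}
    (h : a • T + b • S - S * T = k • 1) :
    a • S⁻¹ + b • T⁻¹ - 1 = k • (S⁻¹ * T⁻¹) := by
  have hS' : S⁻¹ * S = 1 := Matrix.nonsing_inv_mul S ((Matrix.isUnit_iff_isUnit_det S).mp hS)
  have hT' : T * T⁻¹ = 1 := Matrix.mul_nonsing_inv T ((Matrix.isUnit_iff_isUnit_det T).mp hT)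
  have h' := congrArg (fun M => S⁻¹ * M * T⁻¹) h
  simpa [Matrix.mul_add, Matrix.add_mul, Matrix.mul_sub, Matrix.sub_mul, Matrix.mul_assoc, hT',
    ← Matrix.mul_assoc S⁻¹ S, hS'] using h'

/-- The resolvent identity underlying the generating-function formula
`k_f(λ,ν) = C S⁻¹ T⁻¹ C*` for a unitary `U`. -/
theorem resolvent_identity_unitary {N p : ℕ}
    (U : Matrix (Fin N) (Fin N) ℂ) (hU1 : U * Uᴴ = 1) (hU2 : Uᴴ * U = 1)
    (C : Matrix (Fin p) (Fin N) ℂ) (l v : ℂ)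
    (S T : Matrix (Fin N) (Fin N) ℂ)
    (hS : S = 1 - l • ((Real.sqrt 2 : ℂ) • Uᴴ - Complex.I • (1 : Matrix (Fin N) (Fin N) ℂ)))
    (hT : T = 1 - starRingEnd ℂ v •
      ((Real.sqrt 2 : ℂ) • U + Complex.I • (1 : Matrix (Fin N) (Fin N) ℂ)))
    (hSu : IsUnit S) (hTu : IsUnit T) :
    (1 + Complex.I * l) • (C * S⁻¹ * Cᴴ)
        + (1 - Complex.I * starRingEnd ℂ v) • (C * T⁻¹ * Cᴴ) - C * Cᴴ =
      (1 + Complex.I * l - Complex.I * starRingEnd ℂ v - l * starRingEnd ℂ v) •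
        (C * S⁻¹ * T⁻¹ * Cᴴ) := by
  have hsq : (Real.sqrt 2 : ℂ) * Real.sqrt 2 = 2 := by
    rw [← Complex.ofReal_mul, Real.mul_self_sqrt zero_le_two, Complex.ofReal_ofNat]
  set w := starRingEnd ℂ v
  set r : ℂ := (Real.sqrt 2 : ℂ)
  have hS' : S = (1 + Complex.I * l) • 1 - (l * r) • Uᴴ := by rw [hS]; module
  have hT' : T = (1 - Complex.I * w) • 1 - (w * r) • U := by rw [hT]; module
  have hST : (1 + Complex.I * l) • T + (1 - Complex.I * w) • S - S * T =
      (1 + Complex.I * l - Complex.I * w - l * w) • 1 := by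
    rw [hS', hT']
    simp only [Matrix.sub_mul, Matrix.mul_sub, Matrix.smul_mul, Matrix.mul_smul, Matrix.one_mul,
      Matrix.mul_one, hU2]
    match_scalars
    · linear_combination (-l * w) * hsq - (l * w) * Complex.I_sq
    all_goals ring
  have h := congrArg (fun M => C * M * Cᴴ) (smul_inv_add_smul_inv_sub_one hSu hTu hST)
  simpa [Matrix.mul_add, Matrix.add_mul, Matrix.mul_sub, Matrix.sub_mul, Matrix.mul_assoc] using h
end
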